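/- Let 2 ≤ k < n and let A be a k×n (−1,1)-matrix of rank k over ℚ. Then mper A ≤ mper D_{(n,k,k−1)}. Moreover, if (k,n) ≠ (3,4), then equality holds if and only if A can be obtained from D_{(n,k,k−1)} by permutations of rows and columns and multiplications of rows or columns by −1; if (k,n) = (3,4), then equality holds if and only if A can be obtained in this way from D_{(4,3,2)} or from D_{(4,3,3)}. -/

import Mathlib

open Matrix

/-- The permanent of a square matrix. -/
def per {n : ℕ} (A : Matrix (Fin n) (Fin n) ℚ) : ℚ :=
  ∑ σ : Equiv.Perm (Fin n), ∏ i, A i (σ i)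

/-- The rectangular matrix `D_{(n,k,l)}` (`k` rows, `n` columns): `-1` on the first `l`
diagonal entries, `1` elsewhere. -/
def Dr (n k l : ℕ) : Matrix (Fin k) (Fin n) ℚ :=
  fun i j => if (i : ℕ) = (j : ℕ) ∧ (j : ℕ) < l then -1 else 1

/-- `A` is obtained from `B` by permutations of rows and columns and multiplications of
rows or columns by `-1` (rectangular case, no transposition). -/
def RectEquiv {k n : ℕ} (A B : Matrix (Fin k) (Fin n) ℚ) : Prop :=
  ∃ (ρ : Equiv.Perm (Fin k)) (σ : Equiv.Perm (Fin n)) (ε : Fin k → ℚ) (δ : Fin n → ℚ),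
    (∀ i, ε i = 1 ∨ ε i = -1) ∧ (∀ j, δ j = 1 ∨ δ j = -1) ∧
    ∀ i j, A i j = ε i * δ j * B (ρ i) (σ j)

/-- `mper A`: the sum of `|per B|` over all `k × k` submatrices `B` of a `k × n` matrix `A`
obtained by choosing `k` of the `n` columns (keeping their order). -/
def mper {k n : ℕ} (A : Matrix (Fin k) (Fin n) ℚ) : ℚ :=
  ∑ s ∈ (Finset.powersetCard k (Finset.univ : Finset (Fin n))).attach,
    |per (A.submatrix id (s.1.orderEmbOfFin (Finset.mem_powersetCard.mp s.2).2))|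

set_option linter.unusedSectionVars false

section Coefficients

variable {ι α : Type*} [DecidableEq ι] [Fintype α] [DecidableEq α]

/-- The linear form with coefficient vector `v`. -/
noncomputable def lin (v : α → ℚ) : MvPolynomial α ℚ :=
  ∑ j, MvPolynomial.C (v j) * MvPolynomial.X j

/-- The coefficient of the squarefree monomial `∏ j ∈ S, X j`. -/
noncomputable def cf (Q : MvPolynomial α ℚ) (S : Finset α) : ℚ :=
  Q.coeff (Finsupp.indicator S fun _ _ => 1)

/-- The sum of the absolute values of the squarefree coefficients supported in `W`. -/
noncomputable def nrm (W : Finset α) (Q : MvPolynomial α ℚ) : ℚ :=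
  ∑ S ∈ W.powerset, |cf Q S|

/-- The product of the linear forms of the rows in `I`. -/
noncomputable def rowProd (r : ι → α → ℚ) (I : Finset ι) : MvPolynomial α ℚ :=
  ∏ i ∈ I, lin (r i)

theorem cf_lin_mul (v : α → ℚ) (Q : MvPolynomial α ℚ) (S : Finset α) :
    cf (lin v * Q) S = ∑ j ∈ S, v j * cf Q (S.erase j) := by
  classical
  have key : ∀ j, cf (MvPolynomial.C (v j) * MvPolynomial.X j * Q) S =
      if j ∈ S then v j * cf Q (S.erase j) else 0 := by
    intro j
    unfold cf
    rw [mul_assoc, MvPolynomial.coeff_C_mul, MvPolynomial.coeff_X_mul']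
    have hs : j ∈ (Finsupp.indicator S fun _ _ => (1 : ℕ)).support ↔ j ∈ S := by
      simp [Finsupp.indicator_apply]
    by_cases hj : j ∈ S
    · rw [if_pos (hs.2 hj), if_pos hj]
      congr 2
      ext a
      simp only [Finsupp.coe_tsub, Pi.sub_apply, Finsupp.indicator_apply, Finsupp.single_apply,
        Finset.mem_erase]
      by_cases h : j = a
      · subst h; simp [hj]
      · simp [h, Ne.symm h]
    · rw [if_neg (fun h => hj (hs.1 h)), if_neg hj, mul_zero]
  have : cf (lin v * Q) S = ∑ j, cf (MvPolynomial.C (v j) * MvPolynomial.X j * Q) S := by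
    unfold cf lin
    rw [Finset.sum_mul, MvPolynomial.coeff_sum]
  rw [this, Finset.sum_congr rfl fun j _ => key j, Finset.sum_ite_mem, Finset.univ_inter]

theorem cf_one (S : Finset α) : cf (1 : MvPolynomial α ℚ) S = if S = ∅ then 1 else 0 := by
  unfold cf
  rw [MvPolynomial.coeff_one]
  congr 1
  rw [eq_iff_iff]
  constructor
  · intro h
    ext a
    have := DFunLike.congr_fun h a
    simp [Finsupp.indicator_apply] at this
    simp [this]
  · rintro rfl
    ext a
    simp

theorem rowProd_eq_lin_mul (r : ι → α → ℚ) {I : Finset ι} {i : ι} (hi : i ∈ I) :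
    rowProd r I = lin (r i) * rowProd r (I.erase i) :=
  (Finset.mul_prod_erase I (fun i => lin (r i)) hi).symm

theorem cf_rowProd_eq_zero (r : ι → α → ℚ) (I : Finset ι) :
    ∀ S : Finset α, S.card ≠ I.card → cf (rowProd r I) S = 0 := by
  induction I using Finset.induction_on with
  | empty =>
    intro S hS
    rw [rowProd, Finset.prod_empty, cf_one, if_neg]
    rintro rfl
    exact hS rfl
  | insert i I hi ih =>
    intro S hS
    rw [rowProd, Finset.prod_insert hi, cf_lin_mul]
    refine Finset.sum_eq_zero fun j hj => ?_
    rw [show ∏ x ∈ I, lin (r x) = rowProd r I from rfl, ih, mul_zero]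
    rw [Finset.card_erase_of_mem hj]
    rw [Finset.card_insert_of_notMem hi] at hS
    have := Finset.card_pos.2 ⟨j, hj⟩
    omega

theorem sum_powerset_erase (W : Finset α) (F : α → Finset α → ℚ) :
    ∑ S ∈ W.powerset, ∑ j ∈ S, F j (S.erase j) =
      ∑ j ∈ W, ∑ T ∈ (W.erase j).powerset, F j T := by
  rw [Finset.sum_sigma', Finset.sum_sigma']
  refine Finset.sum_bij' (fun x _ => ⟨x.2, x.1.erase x.2⟩) (fun x _ => ⟨insert x.1 x.2, x.1⟩)
    ?_ ?_ ?_ ?_ ?_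
  · rintro ⟨S, j⟩ h
    simp only [Finset.mem_sigma, Finset.mem_powerset] at h ⊢
    exact ⟨h.1 h.2, Finset.erase_subset_erase _ h.1⟩
  · rintro ⟨j, T⟩ h
    simp only [Finset.mem_sigma, Finset.mem_powerset] at h ⊢
    exact ⟨Finset.insert_subset h.1 (h.2.trans (Finset.erase_subset _ _)),
      Finset.mem_insert_self _ _⟩
  · rintro ⟨S, j⟩ h
    simp only [Finset.mem_sigma, Finset.mem_powerset] at h
    simp [Finset.insert_erase h.2]
  · rintro ⟨j, T⟩ h
    simp only [Finset.mem_sigma, Finset.mem_powerset] at h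
    have : j ∉ T := fun hj => by simpa using h.2 hj
    simp [Finset.erase_insert this]
  · rintro ⟨S, j⟩ h
    rfl

theorem nrm_lin_mul_le (v : α → ℚ) (hv : ∀ j, |v j| = 1) (W : Finset α)
    (Q : MvPolynomial α ℚ) : nrm W (lin v * Q) ≤ ∑ j ∈ W, nrm (W.erase j) Q := by
  calc nrm W (lin v * Q) ≤ ∑ S ∈ W.powerset, ∑ j ∈ S, |cf Q (S.erase j)| := by
        refine Finset.sum_le_sum fun S _ => ?_
        rw [cf_lin_mul]
        refine (Finset.abs_sum_le_sum_abs _ _).trans (le_of_eq ?_)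
        exact Finset.sum_congr rfl fun j _ => by rw [abs_mul, hv, one_mul]
    _ = _ := sum_powerset_erase W fun _ T => |cf Q T|

theorem sum_nrm_erase (W : Finset α) (Q : MvPolynomial α ℚ) (m : ℕ)
    (hQ : ∀ S : Finset α, S.card ≠ m → cf Q S = 0) :
    ∑ j ∈ W, nrm (W.erase j) Q = (W.card - m) * nrm W Q := by
  have h : ∀ j ∈ W, nrm (W.erase j) Q = ∑ S ∈ W.powerset, if j ∉ S then |cf Q S| else 0 := by
    intro j _
    rw [← Finset.sum_filter]
    refine Finset.sum_congr ?_ fun _ _ => rfl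
    ext S
    simp [Finset.subset_erase]
  rw [Finset.sum_congr rfl h, Finset.sum_comm, nrm, Finset.mul_sum]
  refine Finset.sum_congr rfl fun S hS => ?_
  have hS := Finset.mem_powerset.1 hS
  by_cases hm : S.card = m
  · rw [← Finset.sum_filter, Finset.sum_const, nsmul_eq_mul, ← Finset.sdiff_eq_filter,
      Finset.card_sdiff_of_subset hS, Nat.cast_sub (Finset.card_le_card hS), hm]
  · simp [hQ S hm]

/-- The sum of `|cf Q (S \ {i, j})|` over the ordered pairs `i ≠ j` in `S` with `s i = s j`. -/
noncomputable def pairSum (s : α → ℚ) (Q : MvPolynomial α ℚ) (S : Finset α) : ℚ :=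
  ∑ i ∈ S, ∑ j ∈ S.erase i, if s i = s j then |cf Q ((S.erase i).erase j)| else 0

theorem sum_sum_erase_comm (S : Finset α) (F : α → α → ℚ) :
    ∑ i ∈ S, ∑ j ∈ S.erase i, F i j = ∑ i ∈ S, ∑ j ∈ S.erase i, F j i := by
  rw [Finset.sum_comm']
  intro x y
  simp only [Finset.mem_erase]
  tauto

theorem abs_cf_pair_le (v w : α → ℚ) (hv : ∀ j, v j = 1 ∨ v j = -1)
    (hw : ∀ j, w j = 1 ∨ w j = -1) (Q : MvPolynomial α ℚ) (S : Finset α) :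
    |cf (lin v * (lin w * Q)) S| ≤ pairSum (fun j => v j * w j) Q S := by
  have h1 : cf (lin v * (lin w * Q)) S =
      ∑ i ∈ S, ∑ j ∈ S.erase i, v i * w j * cf Q ((S.erase i).erase j) := by
    rw [cf_lin_mul]
    refine Finset.sum_congr rfl fun i _ => ?_
    rw [cf_lin_mul, Finset.mul_sum]
    exact Finset.sum_congr rfl fun j _ => by ring
  have h2 : cf (lin v * (lin w * Q)) S =
      ∑ i ∈ S, ∑ j ∈ S.erase i, (v i * w j + v j * w i) / 2 * cf Q ((S.erase i).erase j) := by
    have h3 := h1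
    rw [sum_sum_erase_comm] at h3
    have : cf (lin v * (lin w * Q)) S =
        (cf (lin v * (lin w * Q)) S + cf (lin v * (lin w * Q)) S) / 2 := by ring
    rw [this]
    nth_rewrite 1 [h1]
    rw [h3, ← Finset.sum_add_distrib, Finset.sum_div]
    refine Finset.sum_congr rfl fun i _ => ?_
    rw [← Finset.sum_add_distrib, Finset.sum_div]
    refine Finset.sum_congr rfl fun j _ => ?_
    rw [Finset.erase_right_comm (a := j) (b := i)]
    ring
  rw [h2, pairSum]
  refine (Finset.abs_sum_le_sum_abs _ _).trans (Finset.sum_le_sum fun i _ => ?_)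
  refine (Finset.abs_sum_le_sum_abs _ _).trans (Finset.sum_le_sum fun j _ => ?_)
  rw [abs_mul]
  split_ifs with h
  · refine (mul_le_of_le_one_left (abs_nonneg _) ?_)
    rcases hv i with a | a <;> rcases hv j with b | b <;> rcases hw i with c | c <;>
      rcases hw j with d | d <;> rw [a, b, c, d] <;> norm_num
  · refine le_of_eq (mul_eq_zero_of_left (abs_eq_zero.2 ?_) _)
    revert h
    rcases hv i with a | a <;> rcases hv j with b | b <;> rcases hw i with c | c <;>
      rcases hw j with d | d <;> rw [a, b, c, d] <;> norm_num

theorem sum_pairSum (s : α → ℚ) (Q : MvPolynomial α ℚ) (W : Finset α) :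
    ∑ S ∈ W.powerset, pairSum s Q S =
      ∑ i ∈ W, ∑ j ∈ W.erase i, if s i = s j then nrm ((W.erase i).erase j) Q else 0 := by
  unfold pairSum
  rw [sum_powerset_erase W fun i T => ∑ j ∈ T, if s i = s j then |cf Q (T.erase j)| else 0]
  refine Finset.sum_congr rfl fun i _ => ?_
  rw [sum_powerset_erase _ fun j T => if s i = s j then |cf Q T| else 0]
  refine Finset.sum_congr rfl fun j _ => ?_
  split_ifs with h
  · rfl
  · simp

theorem nrm_pair_le (v w : α → ℚ) (hv : ∀ j, v j = 1 ∨ v j = -1)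
    (hw : ∀ j, w j = 1 ∨ w j = -1) (Q : MvPolynomial α ℚ) (W : Finset α) :
    nrm W (lin v * (lin w * Q)) ≤ ∑ i ∈ W, ∑ j ∈ W.erase i,
      if v i * w i = v j * w j then nrm ((W.erase i).erase j) Q else 0 := by
  rw [← sum_pairSum (fun j => v j * w j)]
  exact Finset.sum_le_sum fun S _ => abs_cf_pair_le v w hv hw Q S

end Coefficients

section Numbers

/-- The value of `mper` on `D_{(n,k,r)}` for `r < k`. -/
def ff : ℕ → ℕ → ℕ → ℚ
  | n, k, 0 => n.descFactorial k
  | n, k, r + 1 => ff n k r - 2 * ff (n - 1) (k - 1) r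

theorem ff_succ (n k r : ℕ) : ff n k (r + 1) = ff n k r - 2 * ff (n - 1) (k - 1) r := by
  rw [ff]

theorem ff_succ_left (r : ℕ) : ∀ n k : ℕ, r ≤ k → k ≤ n →
    ff n (k + 1) r = (n - k) * ff n k r := by
  induction r with
  | zero =>
    intro n k _ hk
    simp only [ff]
    rw [Nat.descFactorial_succ, Nat.cast_mul, Nat.cast_sub hk]
  | succ r ih =>
    intro n k hr hk
    obtain ⟨k, rfl⟩ : ∃ j, k = j + 1 := ⟨k - 1, by omega⟩
    obtain ⟨n, rfl⟩ : ∃ j, n = j + 1 := ⟨n - 1, by omega⟩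
    rw [ff_succ, ff_succ, ih (n + 1) (k + 1) (by omega) hk]
    simp only [Nat.add_sub_cancel]
    rw [ih n k (by omega) (by omega)]
    push_cast
    ring

theorem ff_pred (r : ℕ) : ∀ n q : ℕ, r ≤ q → q < n →
    (n - q) * ff n q r = n * ff (n - 1) q r + 2 * r * ff (n - 2) (q - 1) (r - 1) := by
  induction r with
  | zero =>
    intro n q _ hq
    obtain ⟨n, rfl⟩ : ∃ j, n = j + 1 := ⟨n - 1, by omega⟩
    simp only [ff, Nat.add_sub_cancel]
    have h := Nat.succ_descFactorial n q
    have : ((n + 1 : ℕ) - q : ℚ) = ((n + 1 - q : ℕ) : ℚ) := by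
      rw [Nat.cast_sub (by omega)]
    rw [this, ← Nat.cast_mul, h]
    push_cast
    ring
  | succ r ih =>
    intro n q hr hq
    obtain ⟨q, rfl⟩ : ∃ j, q = j + 1 := ⟨q - 1, by omega⟩
    obtain ⟨n, rfl⟩ : ∃ j, n = j + 2 := ⟨n - 2, by omega⟩
    have h1 := ih (n + 2) (q + 1) (by omega) hq
    have h2 := ih (n + 1) q (by omega) (by omega)
    rw [ff_succ, ff_succ]
    simp only [Nat.add_sub_cancel, show n + 2 - 1 = n + 1 from rfl,
      show n + 1 - 2 = n - 1 from by omega] at h1 h2 ⊢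
    rcases Nat.eq_zero_or_pos r with rfl | hr0
    · push_cast at h1 h2 ⊢
      linear_combination h1 - 2 * h2
    · have h3 := ff_succ n q (r - 1)
      rw [Nat.sub_add_cancel hr0] at h3
      push_cast at h1 h2 ⊢
      linear_combination h1 - 2 * h2 - 2 * r * h3

theorem ff_two_step (n K : ℕ) (hK : 1 ≤ K) (hn : K + 3 < n) :
    ff (n - 2) (K + 1) K = (n - K - 3) * ff (n - 3) K (K - 1) +
      (K - 1) * ff (n - 3) K (K - 2) := by
  obtain ⟨K, rfl⟩ : ∃ j, K = j + 1 := ⟨K - 1, by omega⟩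
  obtain ⟨n, rfl⟩ : ∃ j, n = j + 4 := ⟨n - 4, by omega⟩
  have h1 := ff_succ (n + 2) (K + 2) K
  have h2 := ff_succ_left K (n + 2) (K + 1) (by omega) (by omega)
  have h3 := ff_pred K (n + 2) (K + 1) (by omega) (by omega)
  simp only [Nat.add_sub_cancel, show n + 4 - 2 = n + 2 from rfl, show n + 4 - 3 = n + 1 from rfl,
    show n + 2 - 1 = n + 1 from rfl, show K + 2 - 1 = K + 1 from rfl,
    show K + 1 - 2 = K - 1 from by omega] at h1 h2 h3 ⊢
  rcases Nat.eq_zero_or_pos K with rfl | hK0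
  · push_cast at h1 h2 h3 ⊢
    linear_combination h1 + h2 + h3
  · have h4 := ff_succ (n + 1) (K + 1) (K - 1)
    rw [Nat.sub_add_cancel hK0] at h4
    simp only [Nat.add_sub_cancel] at h4
    push_cast at h1 h2 h3 ⊢
    linear_combination h1 + h2 + h3 + K * h4

theorem ff_top (n K : ℕ) (hn : K + 3 < n) :
    ff n (K + 3) (K + 2) = (n ^ 2 - 5 * n + 8) * ff (n - 2) (K + 1) K +
      2 * K * (2 * n - K - 5) * ff (n - 3) K (K - 1) +
      2 * K * (K - 1) * ff (n - 3) K (K - 2) := by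
  have h0 := ff_two_step n K
  obtain ⟨n, rfl⟩ : ∃ j, n = j + 4 := ⟨n - 4, by omega⟩
  have h1 := ff_succ (n + 4) (K + 3) (K + 1)
  have h2 := ff_succ (n + 4) (K + 3) K
  have h3 := ff_succ (n + 3) (K + 2) K
  have h4 := ff_succ_left K (n + 3) (K + 1) (by omega) (by omega)
  have h5 := ff_pred K (n + 3) (K + 1) (by omega) (by omega)
  have h6 := ff_succ_left K (n + 4) (K + 2) (by omega) (by omega)
  have h7 := ff_pred K (n + 4) (K + 2) (by omega) (by omega)
  simp only [Nat.add_sub_cancel, show n + 4 - 2 = n + 2 from rfl, show n + 4 - 3 = n + 1 from rfl,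
    show n + 4 - 1 = n + 3 from rfl, show n + 3 - 2 = n + 1 from rfl,
    show K + 2 - 1 = K + 1 from rfl,
    show n + 3 - 1 = n + 2 from rfl, show K + 3 - 1 = K + 2 from rfl] at *
  rcases Nat.eq_zero_or_pos K with rfl | hK0
  · push_cast at *
    simp only [mul_zero, zero_mul, add_zero] at *
    linear_combination h1 + h2 - 2 * h3 + (n : ℚ) * h4 + h6 + h7 - (4 - (n + 4 : ℚ)) * h5
  · have h8 := ff_succ (n + 2) (K + 1) (K - 1)
    rw [Nat.sub_add_cancel hK0] at h8
    simp only [Nat.add_sub_cancel, show n + 2 - 1 = n + 1 from rfl] at h8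
    have h9 := h0 hK0 hn
    push_cast at *
    linear_combination h1 + h2 - 2 * h3 + (n : ℚ) * h4 + h6 + h7 - (4 - (n + 4 : ℚ)) * h5 -
      2 * K * h8 + 2 * K * h9

theorem ff_one (n : ℕ) : ff n 1 0 = n := by simp [ff]

theorem ff_two (n : ℕ) (hn : 2 ≤ n) : ff n 2 1 = (n - 1) * (n - 2) := by
  obtain ⟨n, rfl⟩ : ∃ j, n = j + 2 := ⟨n - 2, by omega⟩
  simp [ff, Nat.descFactorial_succ]
  ring

theorem ff_pos (k : ℕ) : ∀ n : ℕ, 1 ≤ k → k < n → 0 < ff n k (k - 1) := by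
  induction k using Nat.strong_induction_on with
  | _ k ih =>
    intro n hk hn
    match k, hk with
    | 1, _ => rw [Nat.sub_self, ff_one]; exact_mod_cast (by omega : 0 < n)
    | 2, _ =>
      rw [show 2 - 1 = 1 from rfl, ff_two n (by omega)]
      have : (3 : ℚ) ≤ n := by exact_mod_cast hn
      nlinarith
    | K + 3, _ =>
      rw [show K + 3 - 1 = K + 2 from rfl, ff_top n K hn]
      have hd := ih (K + 1) (by omega) (n - 2) (by omega) (by omega)
      rw [Nat.add_sub_cancel] at hd
      have hnK : (K + 4 : ℚ) ≤ n := by exact_mod_cast hn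
      have hK0 : (0 : ℚ) ≤ K := Nat.cast_nonneg K
      have h1 : 0 < ((n : ℚ) ^ 2 - 5 * n + 8) * ff (n - 2) (K + 1) K :=
        mul_pos (by nlinarith) hd
      have h2 : 0 ≤ 2 * (K : ℚ) * (2 * n - K - 5) * ff (n - 3) K (K - 1) := by
        rcases Nat.eq_zero_or_pos K with rfl | hK
        · simp
        · exact mul_nonneg (mul_nonneg (by positivity) (by linarith))
            (ih K (by omega) (n - 3) (by omega) (by omega)).le
      have h3 : 0 ≤ 2 * (K : ℚ) * (K - 1) * ff (n - 3) K (K - 2) := by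
        rcases Nat.lt_or_ge K 2 with hK | hK
        · interval_cases K <;> simp
        · have hg := ih K (by omega) (n - 3) (by omega) (by omega)
          have hh := ih (K - 1) (by omega) (n - 4) (by omega) (by omega)
          have h4 := ff_succ (n - 3) K (K - 2)
          rw [show K - 2 + 1 = K - 1 by omega, show n - 3 - 1 = n - 4 by omega] at h4
          rw [show K - 1 - 1 = K - 2 by omega] at hh
          have : (2 : ℚ) ≤ K := by exact_mod_cast hK
          exact mul_nonneg (mul_nonneg (by positivity) (by linarith)) (by linarith)
      linarith

end Numbers

section Independence

variable {ι α : Type*} [DecidableEq ι] [DecidableEq α]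

/-- The rows in `I`, restricted to the columns in `W`, are linearly independent. -/
def Ind (r : ι → α → ℚ) (I : Finset ι) (W : Finset α) : Prop :=
  ∀ z : ι → ℚ, (∀ j ∈ W, ∑ i ∈ I, z i * r i j = 0) → ∀ i ∈ I, z i = 0

/-- The rows `x` and `y` are proportional on the columns in `W`. -/
def PropOn (r : ι → α → ℚ) (x y : ι) (W : Finset α) : Prop :=
  ∃ l : ℚ, ∀ j ∈ W, r x j = l * r y j

open Classical in
/-- The columns `j ∈ W` such that a combination of the rows in `Q` is supported, within `W`,
on `j` only. -/
noncomputable def colo (r : ι → α → ℚ) (Q : Finset ι) (W : Finset α) : Finset α :=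
  W.filter fun j => ∃ z : ι → ℚ, ∑ i ∈ Q, z i * r i j ≠ 0 ∧
    ∀ l ∈ W.erase j, ∑ i ∈ Q, z i * r i l = 0

variable {r : ι → α → ℚ} {I J Q : Finset ι} {W : Finset α}

theorem mem_colo {j : α} : j ∈ colo r Q W ↔ j ∈ W ∧ ∃ z : ι → ℚ, ∑ i ∈ Q, z i * r i j ≠ 0 ∧
    ∀ l ∈ W.erase j, ∑ i ∈ Q, z i * r i l = 0 := by
  simp only [colo, Finset.mem_filter]

theorem colo_subset : colo r Q W ⊆ W := fun _ h => (mem_colo.1 h).1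

theorem colo_erase {i j : α} (hi : i ∈ colo r Q W) (hij : i ≠ j) : i ∈ colo r Q (W.erase j) := by
  obtain ⟨hiW, z, hz, h⟩ := mem_colo.1 hi
  refine mem_colo.2 ⟨Finset.mem_erase.2 ⟨hij, hiW⟩, z, hz, fun l hl => h l ?_⟩
  simp only [Finset.mem_erase] at hl ⊢
  tauto

theorem Ind.mono (h : Ind r I W) (hJ : J ⊆ I) : Ind r J W := by
  intro z hz i hi
  have := h (fun i => if i ∈ J then z i else 0) (fun j hj => ?_) i (hJ hi)
  · simpa [hi] using this
  · refine Eq.trans ?_ (hz j hj)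
    rw [← Finset.sum_subset hJ fun x _ hx => by rw [if_neg hx, zero_mul]]
    exact Finset.sum_congr rfl fun i hi => by rw [if_pos hi]

theorem Ind.erase (h : Ind r Q W) {j : α} (hj : j ∉ colo r Q W) : Ind r Q (W.erase j) := by
  intro z hz
  refine h z fun l hl => ?_
  by_cases hlj : l = j
  · subst hlj
    by_contra hne
    exact hj (mem_colo.2 ⟨hl, z, hne, hz⟩)
  · exact hz l (Finset.mem_erase.2 ⟨hlj, hl⟩)

theorem Ind.erase_erase (h : Ind r Q W) {j : α} (hj : j ∈ colo r Q W) :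
    ∃ i ∈ Q, Ind r (Q.erase i) (W.erase j) := by
  obtain ⟨hjW, z, hz, h0⟩ := mem_colo.1 hj
  obtain ⟨i, hi, hzi⟩ := Finset.exists_ne_zero_of_sum_ne_zero hz
  have hzi : z i ≠ 0 := left_ne_zero_of_mul hzi
  refine ⟨i, hi, fun y hy => ?_⟩
  set c := ∑ x ∈ Q.erase i, y x * r x j with hc
  set m := ∑ x ∈ Q, z x * r x j with hm
  let y' : ι → ℚ := fun x => (if x = i then 0 else y x) - c / m * z x
  have hsum : ∀ l, ∑ x ∈ Q, y' x * r x l =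
      ∑ x ∈ Q.erase i, y x * r x l - c / m * ∑ x ∈ Q, z x * r x l := by
    intro l
    have h1 : ∑ x ∈ Q.erase i, y x * r x l = ∑ x ∈ Q, (if x = i then 0 else y x) * r x l := by
      rw [← Finset.add_sum_erase _ _ hi, if_pos rfl, zero_mul, zero_add]
      exact Finset.sum_congr rfl fun x hx => by rw [if_neg (Finset.ne_of_mem_erase hx)]
    rw [h1, Finset.mul_sum, ← Finset.sum_sub_distrib]
    exact Finset.sum_congr rfl fun x _ => by simp only [y']; ring
  have hy' : ∀ x ∈ Q, y' x = 0 := by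
    refine h y' fun l hl => ?_
    rw [hsum]
    by_cases hlj : l = j
    · subst hlj
      rw [← hc, ← hm, div_mul_cancel₀ _ hz, sub_self]
    · have hl' := Finset.mem_erase.2 ⟨hlj, hl⟩
      rw [hy l hl', h0 l hl', mul_zero, sub_zero]
  have hcm : c / m = 0 := by
    have := hy' i hi
    simp only [y', if_true, zero_sub, neg_eq_zero, mul_eq_zero] at this
    tauto
  intro x hx
  have := hy' x (Finset.mem_of_mem_erase hx)
  simpa [y', Finset.ne_of_mem_erase hx, hcm] using this

theorem exists_spanning_sdiff (C : Finset α) (hC : C ⊆ colo r Q W) :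
    ∃ Q' ⊆ Q, Q'.card + C.card = Q.card ∧
      ∀ x ∈ Q, ∃ y : ι → ℚ, ∀ j ∈ W \ C, r x j = ∑ i ∈ Q', y i * r i j := by
  induction C using Finset.induction_on with
  | empty =>
    refine ⟨Q, subset_rfl, by simp, fun x hx => ⟨fun i => if i = x then 1 else 0, ?_⟩⟩
    intro j _
    simp [hx]
  | insert c C hc ih =>
    obtain ⟨Q', hQ', hcard, hspan⟩ := ih ((Finset.subset_insert _ _).trans hC)
    choose! y hy using hspan
    obtain ⟨hcW, z, hz, h0⟩ := mem_colo.1 (hC (Finset.mem_insert_self c C))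
    let w : ι → ℚ := fun i => ∑ x ∈ Q, z x * y x i
    have hw : ∀ j ∈ W \ C, ∑ x ∈ Q, z x * r x j = ∑ i ∈ Q', w i * r i j := by
      intro j hj
      simp only [w, Finset.sum_mul]
      rw [Finset.sum_comm]
      refine Finset.sum_congr rfl fun x hx => ?_
      rw [hy x hx j hj, Finset.mul_sum]
      exact Finset.sum_congr rfl fun i _ => by ring
    have hne : ∑ i ∈ Q', w i * r i c ≠ 0 := by
      rw [← hw c (Finset.mem_sdiff.2 ⟨hcW, hc⟩)]
      exact hz
    obtain ⟨i, hi, hwi⟩ := Finset.exists_ne_zero_of_sum_ne_zero hne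
    have hwi : w i ≠ 0 := left_ne_zero_of_mul hwi
    refine ⟨Q'.erase i, (Finset.erase_subset _ _).trans hQ', ?_, fun x hx => ?_⟩
    · rw [Finset.card_erase_of_mem hi, Finset.card_insert_of_notMem hc]
      have := Finset.card_pos.2 ⟨i, hi⟩
      omega
    · refine ⟨fun t => y x t - y x i / w i * w t, fun j hj => ?_⟩
      simp only [Finset.mem_sdiff, Finset.mem_insert, not_or] at hj
      have hj' : j ∈ W \ C := Finset.mem_sdiff.2 ⟨hj.1, hj.2.2⟩
      have hzero : ∑ i ∈ Q', w i * r i j = 0 := by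
        rw [← hw j hj']
        exact h0 j (Finset.mem_erase.2 ⟨hj.2.1, hj.1⟩)
      have h1 : ∑ t ∈ Q', (y x t - y x i / w i * w t) * r t j = r x j := by
        rw [hy x hx j hj']
        simp only [sub_mul, Finset.sum_sub_distrib, mul_assoc]
        rw [← Finset.mul_sum, hzero, mul_zero, sub_zero]
      rw [← h1, ← Finset.add_sum_erase _ _ hi, div_mul_cancel₀ _ hwi, sub_self, zero_mul, zero_add]

theorem card_colo_lt (hr : ∀ i j, r i j = 1 ∨ r i j = -1) (hQ : Q.Nonempty)
    (hW : Q.card < W.card) : (colo r Q W).card < Q.card := by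
  obtain ⟨Q', _, hcard, hspan⟩ := exists_spanning_sdiff (colo r Q W) subset_rfl
  rcases Q'.eq_empty_or_nonempty with rfl | hne
  · obtain ⟨x, hx⟩ := hQ
    obtain ⟨y, hy⟩ := hspan x hx
    obtain ⟨j, hj⟩ : (W \ colo r Q W).Nonempty := by
      rw [← Finset.card_pos, Finset.card_sdiff_of_subset colo_subset]
      rw [Finset.card_empty] at hcard
      omega
    have := hy j hj
    rcases hr x j with h | h <;> simp [h] at this
  · have := hne.card_pos
    omega

theorem propOn_of_card_colo (hr : ∀ i j, r i j = 1 ∨ r i j = -1)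
    (hW : Q.card < W.card) (hC : (colo r Q W).card + 1 = Q.card) {x y : ι} (hx : x ∈ Q)
    (hy : y ∈ Q) : PropOn r x y (W \ colo r Q W) := by
  obtain ⟨Q', _, hcard, hspan⟩ := exists_spanning_sdiff (colo r Q W) subset_rfl
  obtain ⟨i, rfl⟩ := Finset.card_eq_one.1 (show Q'.card = 1 by omega)
  obtain ⟨a, ha⟩ := hspan x hx
  obtain ⟨b, hb⟩ := hspan y hy
  simp only [Finset.sum_singleton] at ha hb
  obtain ⟨j, hj⟩ : (W \ colo r Q W).Nonempty := by
    rw [← Finset.card_pos, Finset.card_sdiff_of_subset colo_subset]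
    omega
  have hb0 : b i ≠ 0 := by
    intro h0
    have := hb j hj
    rw [h0, zero_mul] at this
    rcases hr y j with h | h <;> rw [h] at this <;> norm_num at this
  exact ⟨a i / b i, fun l hl => by rw [ha l hl, hb l hl]; field_simp⟩

theorem Ind.not_propOn (h : Ind r I W) {x y : ι} (hx : x ∈ I) (hy : y ∈ I) (hxy : x ≠ y) :
    ¬ PropOn r x y W := by
  rintro ⟨l, hl⟩
  have := h.mono (J := {x, y}) (by intro; simp; rintro (rfl | rfl) <;> assumption)
    (fun i => if i = x then 1 else -l) (fun j hj => ?_) x (by simp)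
  · simp at this
  · rw [Finset.sum_pair hxy]
    simp [hxy.symm, hl j hj]

end Independence

section Signs

variable {ι α : Type*} [DecidableEq ι] [DecidableEq α] {r : ι → α → ℚ}

theorem row_sq (hr : ∀ i j, r i j = 1 ∨ r i j = -1) (i : ι) (j : α) : r i j * r i j = 1 := by
  rcases hr i j with h | h <;> rw [h] <;> norm_num

theorem propOn_iff (hr : ∀ i j, r i j = 1 ∨ r i j = -1) {x y : ι} {W : Finset α} :
    PropOn r x y W ↔ ∃ e : ℚ, (e = 1 ∨ e = -1) ∧ ∀ j ∈ W, r x j * r y j = e := by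
  constructor
  · rintro ⟨l, hl⟩
    rcases W.eq_empty_or_nonempty with rfl | ⟨j, hj⟩
    · exact ⟨1, Or.inl rfl, by simp⟩
    · refine ⟨l, ?_, fun i hi => by rw [hl i hi, mul_assoc, row_sq hr, mul_one]⟩
      have := hl j hj
      rcases hr x j with h | h <;> rcases hr y j with h' | h' <;> rw [h, h'] at this
      · left; linarith
      · right; linarith
      · right; linarith
      · left; linarith
  · rintro ⟨e, -, he⟩
    exact ⟨e, fun j hj => by rw [← he j hj, mul_assoc, row_sq hr, mul_one]⟩

theorem PropOn.symm (hr : ∀ i j, r i j = 1 ∨ r i j = -1) {x y : ι} {W : Finset α}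
    (h : PropOn r x y W) : PropOn r y x W := by
  rw [propOn_iff hr] at h ⊢
  simpa only [mul_comm] using h

theorem PropOn.trans {x y z : ι} {W : Finset α} (h : PropOn r x y W) (h' : PropOn r y z W) :
    PropOn r x z W := by
  obtain ⟨a, ha⟩ := h
  obtain ⟨b, hb⟩ := h'
  exact ⟨a * b, fun j hj => by rw [ha j hj, hb j hj, mul_assoc]⟩

theorem prod_eq_or (hr : ∀ i j, r i j = 1 ∨ r i j = -1) (x y : ι) (j : α) :
    r x j * r y j = 1 ∨ r x j * r y j = -1 := by
  rcases hr x j with h | h <;> rcases hr y j with h' | h' <;> rw [h, h'] <;> norm_num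

end Signs

section Weights

variable {α : Type*} [DecidableEq α]

theorem sum_if_mem_le (F D : Finset α) (M : α → ℚ) (a b : ℚ)
    (h : ∀ i ∈ F, M i ≤ a + if i ∈ D then b else 0) :
    ∑ i ∈ F, M i ≤ F.card * a + (F ∩ D).card * b := by
  refine (Finset.sum_le_sum h).trans (le_of_eq ?_)
  rw [Finset.sum_add_distrib, Finset.sum_const, nsmul_eq_mul, Finset.sum_ite_mem,
    Finset.sum_const, nsmul_eq_mul]

theorem eq_of_sum_if_mem_eq (F D : Finset α) (M : α → ℚ) (a b : ℚ)
    (h : ∀ i ∈ F, M i ≤ a + if i ∈ D then b else 0)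
    (he : F.card * a + (F ∩ D).card * b ≤ ∑ i ∈ F, M i) :
    ∀ i ∈ F, M i = a + if i ∈ D then b else 0 := by
  refine (Finset.sum_eq_sum_iff_of_le h).1 (le_antisymm (Finset.sum_le_sum h) (le_trans ?_ he))
  rw [Finset.sum_add_distrib, Finset.sum_const, nsmul_eq_mul, Finset.sum_ite_mem,
    Finset.sum_const, nsmul_eq_mul]

theorem numeric_bound {n K u t cU cV : ℕ} {d g g' : ℚ} (hd : 0 < d) (hg : 0 < g)
    (hg' : 2 ≤ K → g < g') (hn : n = u + t) (hu : 2 ≤ u) (ht : 2 ≤ t) (hcu : cU ≤ u)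
    (hcv : cV ≤ t) (hc : cU + cV ≤ K) (hKn : K + 4 ≤ n) (hcase : cU + cV = K ∨ 2 ≤ K) :
    let T := (u - cU) * ((u - 1) * d + (K - cV) * (2 * g)) +
        cU * ((u - 1) * (d + 2 * g) + (K - 1) * (2 * g')) +
        (t - cV) * ((t - 1) * d + (K - cU) * (2 * g)) +
        cV * ((t - 1) * (d + 2 * g) + (K - 1) * (2 * g'))
    let B := ((n : ℚ) ^ 2 - 5 * n + 8) * d + 2 * K * (2 * n - K - 5) * g + 2 * K * (K - 1) * g'
    T ≤ B ∧ (B ≤ T → cU + cV = K ∧ (u = 2 ∨ t = 2)) := by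
  intro T B
  have hpart : (0 : ℚ) ≤ cU * (t - 2) + cV * (u - 2) - cU * cV := by
    have hu' : (2 : ℚ) ≤ u := by exact_mod_cast hu
    have ht' : (2 : ℚ) ≤ t := by exact_mod_cast ht
    rcases (by omega : cU + 2 ≤ u ∨ cV + 2 ≤ t) with h | h
    · have h : (cU + 2 : ℚ) ≤ u := by exact_mod_cast h
      have h1 : (0 : ℚ) ≤ cU * (t - 2) := mul_nonneg (by positivity) (by linarith)
      have h2 : (0 : ℚ) ≤ cV * (u - 2 - cU) := mul_nonneg (by positivity) (by linarith)
      linarith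
    · have h : (cV + 2 : ℚ) ≤ t := by exact_mod_cast h
      have h1 : (0 : ℚ) ≤ cV * (u - 2) := mul_nonneg (by positivity) (by linarith)
      have h2 : (0 : ℚ) ≤ cU * (t - 2 - cV) := mul_nonneg (by positivity) (by linarith)
      linarith
  obtain ⟨e, he⟩ : ∃ e : ℕ, K = cU + cV + e := ⟨K - (cU + cV), by omega⟩
  have hdiff : B - T = 2 * ((u - 2) * (t - 2)) * d +
      4 * (cU * (t - 2) + cV * (u - 2) - cU * cV) * g +
      2 * e * ((n - 5 - K) * g + (K - 1) * g') := by
    simp only [B, T]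
    rw [he, hn]
    push_cast
    ring
  have hut : (0 : ℚ) ≤ (u - 2) * (t - 2) := by
    have hu' : (2 : ℚ) ≤ u := by exact_mod_cast hu
    have ht' : (2 : ℚ) ≤ t := by exact_mod_cast ht
    exact mul_nonneg (by linarith) (by linarith)
  have h1 : 0 ≤ 2 * (((u : ℚ) - 2) * (t - 2)) * d := by positivity
  have h2 : 0 ≤ 4 * ((cU : ℚ) * (t - 2) + cV * (u - 2) - cU * cV) * g := by positivity
  have h3 : e ≠ 0 → 0 < 2 * (e : ℚ) * ((n - 5 - K) * g + (K - 1) * g') := by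
    intro he0
    have hK : 2 ≤ K := by omega
    have hgg := hg' hK
    have hK' : (2 : ℚ) ≤ K := by exact_mod_cast hK
    have hn' : (K + 4 : ℚ) ≤ n := by exact_mod_cast hKn
    have he1 : (0 : ℚ) < e := by exact_mod_cast Nat.pos_of_ne_zero he0
    have a1 : 0 ≤ ((n : ℚ) - 4 - K) * g := mul_nonneg (by linarith) hg.le
    have a2 : 0 ≤ ((K : ℚ) - 2) * g' := mul_nonneg (by linarith) (by linarith)
    exact mul_pos (by positivity) (by linarith)
  have h3' : 0 ≤ 2 * (e : ℚ) * ((n - 5 - K) * g + (K - 1) * g') := by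
    rcases eq_or_ne e 0 with rfl | he0
    · simp
    · exact (h3 he0).le
  refine ⟨by linarith, fun hBT => ⟨?_, ?_⟩⟩
  · by_contra hne
    have := h3 (by omega)
    linarith
  · have h4 : 2 * (((u : ℚ) - 2) * (t - 2)) * d = 0 := by linarith
    have h5 : ((u : ℚ) - 2) * (t - 2) = 0 := by
      rcases mul_eq_zero.1 h4 with h | h
      · linarith
      · exact absurd h hd.ne'
    rcases mul_eq_zero.1 h5 with h | h
    · left
      have : (u : ℚ) = 2 := by linarith
      exact_mod_cast this
    · right
      have : (t : ℚ) = 2 := by linarith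
      exact_mod_cast this

variable {W C : Finset α} {s : α → ℚ} {N : α → α → ℚ} {D : α → Finset α} {K : ℕ} {d g g' : ℚ}

theorem sum_part_eq (hs : ∀ j, s j = 1 ∨ s j = -1) (hCW : C ⊆ W) (b : ℚ → ℚ) (b' : ℚ → ℚ) :
    ∑ j ∈ W, (if j ∈ C then b' (s j) else b (s j)) =
      ((W.filter (s · = 1)).card - (C.filter (s · = 1)).card) * b 1 +
        (C.filter (s · = 1)).card * b' 1 +
      ((W.filter (s · = -1)).card - (C.filter (s · = -1)).card) * b (-1) +
        (C.filter (s · = -1)).card * b' (-1) := by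
  have key : ∀ e : ℚ, ∑ j ∈ W.filter (s · = e), (if j ∈ C then b' (s j) else b (s j)) =
      ((W.filter (s · = e)).card - (C.filter (s · = e)).card) * b e +
        (C.filter (s · = e)).card * b' e := by
    intro e
    have h1 : (W.filter (s · = e)).filter (· ∈ C) = C.filter (s · = e) := by
      ext j
      simp only [Finset.mem_filter]
      constructor
      · tauto
      · rintro ⟨h, h'⟩
        exact ⟨⟨hCW h, h'⟩, h⟩
    have h2 := Finset.card_filter_add_card_filter_not (s := W.filter (s · = e)) (· ∈ C)
    rw [h1] at h2
    have h2' : ((C.filter (s · = e)).card : ℚ) +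
        ((W.filter (s · = e)).filter (fun j => ¬ j ∈ C)).card = (W.filter (s · = e)).card := by
      exact_mod_cast h2
    rw [Finset.sum_ite, h1, Finset.sum_congr (g := fun _ => b' e) rfl, Finset.sum_const,
      Finset.sum_congr (g := fun _ => b e) rfl, Finset.sum_const, nsmul_eq_mul, nsmul_eq_mul,
      ← h2']
    · ring
    · intro j hj
      rw [(Finset.mem_filter.1 (Finset.mem_filter.1 hj).1).2]
    · intro j hj
      rw [(Finset.mem_filter.1 hj).2]
  rw [← Finset.sum_filter_add_sum_filter_not W (s · = 1), key 1]
  have h3 : W.filter (fun j => ¬ s j = 1) = W.filter (s · = -1) := by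
    refine Finset.filter_congr fun j _ => ?_
    rcases hs j with h | h <;> rw [h] <;> norm_num
  rw [h3, key (-1)]
  ring

/-- The bound on the sum of the weights of the pairs `i ≠ j` with `s i = s j`, when the weight
exceeds `d` only for the exceptional pairs described by `C` and `D`. -/
theorem sum_weights_le (hs : ∀ j, s j = 1 ∨ s j = -1) (hCW : C ⊆ W)
    (hu : 2 ≤ (W.filter (s · = 1)).card) (ht : 2 ≤ (W.filter (s · = -1)).card)
    (hKn : K + 4 ≤ W.card) (hCK : C.card ≤ K) (hcase : C.card = K ∨ 2 ≤ K)
    (hd : 0 < d) (hg : 0 < g) (hg' : 2 ≤ K → g < g')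
    (hN : ∀ j ∈ W, j ∉ C → ∀ i ∈ W.erase j, N j i ≤ d + if i ∈ D j then 2 * g else 0)
    (hD : ∀ j ∈ W, j ∉ C → C ⊆ D j ∧ (D j).card ≤ K)
    (hN' : ∀ j ∈ C, ∀ i ∈ W.erase j, N j i ≤ d + 2 * g + if i ∈ D j then 2 * g' else 0)
    (hD' : ∀ j ∈ C, (D j).card < K) :
    let T := ∑ j ∈ W, ∑ i ∈ W.erase j, if s j = s i then N j i else 0
    let B := ((W.card : ℚ) ^ 2 - 5 * W.card + 8) * d + 2 * K * (2 * W.card - K - 5) * g +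
      2 * K * (K - 1) * g'
    T ≤ B ∧ (B ≤ T → C.card = K ∧
      ((W.filter (s · = 1)).card = 2 ∨ (W.filter (s · = -1)).card = 2) ∧
      ∀ j ∈ W, j ∉ C → ∀ i ∈ W, i ∉ C → i ≠ j → s i = s j → N j i = d) := by
  intro T B
  have hneg : ∀ X : Finset α, X.filter (s · = 1) ∪ X.filter (s · = -1) = X := by
    intro X
    rw [← Finset.filter_or]
    exact Finset.filter_true_of_mem fun j _ => hs j
  have hdisj : ∀ X : Finset α, Disjoint (X.filter (s · = 1)) (X.filter (s · = -1)) := by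
    intro X
    rw [Finset.disjoint_filter]
    intro j _ h1 h2
    rw [h1] at h2
    norm_num at h2
  have hcard : ∀ X : Finset α, X.card = (X.filter (s · = 1)).card + (X.filter (s · = -1)).card :=
    fun X => by rw [← Finset.card_union_of_disjoint (hdisj X), hneg]
  let F : α → Finset α := fun j => (W.erase j).filter (s j = s ·)
  have hF : ∀ j, ∑ i ∈ W.erase j, (if s j = s i then N j i else 0) = ∑ i ∈ F j, N j i :=
    fun j => (Finset.sum_filter _ _).symm
  have hFW : ∀ j, ∀ i ∈ F j, i ∈ W.erase j := fun j i hi => (Finset.mem_filter.1 hi).1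
  have hFcard : ∀ j ∈ W, ((F j).card : ℚ) = (W.filter (s · = s j)).card - 1 := by
    intro j hj
    have : F j = (W.filter (s · = s j)).erase j := by
      ext i
      simp only [F, Finset.mem_filter, Finset.mem_erase]
      tauto
    have hmem : j ∈ W.filter (s · = s j) := Finset.mem_filter.2 ⟨hj, rfl⟩
    rw [this, Finset.card_erase_of_mem hmem, Nat.cast_sub (Finset.card_pos.2 ⟨j, hmem⟩),
      Nat.cast_one]
  let b : ℚ → ℚ := fun e => ((W.filter (s · = e)).card - 1) * d +
    (K - (C.filter (s · = -e)).card) * (2 * g)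
  let b' : ℚ → ℚ := fun e => ((W.filter (s · = e)).card - 1) * (d + 2 * g) +
    (K - 1) * (2 * g')
  have hout : ∀ j ∈ W, j ∉ C →
      (F j).card * d + ((F j) ∩ D j).card * (2 * g) ≤ b (s j) := by
    intro j hj hjC
    rw [hFcard j hj]
    have h1 : ((F j) ∩ D j).card + (C.filter (s · = -s j)).card ≤ K := by
      rw [← Finset.card_union_of_disjoint]
      · refine (Finset.card_le_card ?_).trans (hD j hj hjC).2
        refine Finset.union_subset Finset.inter_subset_right ?_
        exact (Finset.filter_subset _ _).trans (hD j hj hjC).1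
      · rw [Finset.disjoint_left]
        intro i hi hi'
        have h1 := (Finset.mem_filter.1 (Finset.mem_inter.1 hi).1).2
        have h2 := (Finset.mem_filter.1 hi').2
        rw [h1] at h2
        rcases hs i with h | h <;> rw [h] at h2 <;> norm_num at h2
    have h1 : (((F j) ∩ D j).card : ℚ) ≤ K - (C.filter (s · = -s j)).card := by
      have : (((F j) ∩ D j).card + (C.filter (s · = -s j)).card : ℚ) ≤ K := by exact_mod_cast h1
      linarith
    exact add_le_add le_rfl (mul_le_mul_of_nonneg_right h1 (by linarith))
  have hR : ∀ j ∈ W, ∑ i ∈ W.erase j, (if s j = s i then N j i else 0) ≤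
      if j ∈ C then b' (s j) else b (s j) := by
    intro j hj
    rw [hF]
    split_ifs with hjC
    · refine (sum_if_mem_le _ (D j) _ _ _ fun i hi => hN' j hjC i (hFW j i hi)).trans ?_
      rw [hFcard j hj]
      rcases Nat.lt_or_ge K 2 with hK | hK
      · have h0 : (D j).card < K := hD' j hjC
        have h1 : K = 1 := by omega
        have h2 : D j = ∅ := Finset.card_eq_zero.1 (by omega)
        simp only [b']
        rw [h2, h1]
        simp
      · have h1 : ((F j ∩ D j).card : ℚ) ≤ K - 1 := by
          have h2 := (Finset.card_le_card (Finset.inter_subset_right : F j ∩ D j ⊆ D j)).trans_lt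
            (hD' j hjC)
          have : ((F j ∩ D j).card + 1 : ℚ) ≤ K := by exact_mod_cast h2
          linarith
        have := hg' hK
        exact add_le_add le_rfl (mul_le_mul_of_nonneg_right h1 (by linarith))
    · exact (sum_if_mem_le _ (D j) _ _ _ fun i hi => hN j hj hjC i (hFW j i hi)).trans
        (hout j hj hjC)
  have hTB : T ≤ ∑ j ∈ W, if j ∈ C then b' (s j) else b (s j) := Finset.sum_le_sum hR
  have hsum := sum_part_eq hs hCW b b'
  have hnum := numeric_bound (n := W.card) (u := (W.filter (s · = 1)).card)
    (t := (W.filter (s · = -1)).card) (cU := (C.filter (s · = 1)).card)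
    (cV := (C.filter (s · = -1)).card) hd hg hg' (hcard W) hu ht
    (Finset.card_le_card (Finset.filter_subset_filter _ hCW))
    (Finset.card_le_card (Finset.filter_subset_filter _ hCW)) (by rw [← hcard]; exact hCK) hKn
    (by rw [← hcard]; exact hcase)
  rw [← hcard C] at hnum
  simp only [b, b', neg_neg] at hsum
  dsimp only at hnum
  rw [← hsum] at hnum
  refine ⟨hTB.trans hnum.1, fun hBT => ?_⟩
  obtain ⟨hCeq, hut⟩ := hnum.2 (hBT.trans hTB)
  refine ⟨hCeq, hut, fun j hj hjC i hi hiC hij hsij => ?_⟩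
  have hall := (Finset.sum_eq_sum_iff_of_le hR).1 (le_antisymm hTB (hnum.1.trans hBT)) j hj
  rw [hF, if_neg hjC] at hall
  have hDC : D j = C :=
    (Finset.eq_of_subset_of_card_le (hD j hj hjC).1 (by rw [hCeq]; exact (hD j hj hjC).2)).symm
  have := eq_of_sum_if_mem_eq (F j) (D j) (N j) d (2 * g)
    (fun i hi => hN j hj hjC i (hFW j i hi)) (by rw [hall]; exact hout j hj hjC) i
    (Finset.mem_filter.2 ⟨Finset.mem_erase.2 ⟨hij, hi⟩, hsij.symm⟩)
  rw [this, hDC, if_neg hiC, add_zero]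

end Weights

section Adjacency

variable {ι α : Type*} [DecidableEq ι] [DecidableEq α] {r : ι → α → ℚ}

/-- The rows `x` and `y` are proportional on `W` with at most one column removed. -/
def Adj (r : ι → α → ℚ) (W : Finset α) (x y : ι) : Prop :=
  ∃ a ∈ W, PropOn r x y (W.erase a)

variable {W : Finset α}

theorem Adj.symm (hr : ∀ i j, r i j = 1 ∨ r i j = -1) {x y : ι} (h : Adj r W x y) : Adj r W y x :=
  h.imp fun _ ha => ⟨ha.1, ha.2.symm hr⟩

theorem Adj.exists_sign (hr : ∀ i j, r i j = 1 ∨ r i j = -1) {x y : ι} (h : Adj r W x y)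
    (hp : ¬ PropOn r x y W) :
    ∃ a ∈ W, ∃ e : ℚ, (e = 1 ∨ e = -1) ∧ (∀ j ∈ W, j ≠ a → r x j * r y j = e) ∧
      r x a * r y a = -e := by
  obtain ⟨a, ha, h⟩ := h
  obtain ⟨e, he, h⟩ := (propOn_iff hr).1 h
  refine ⟨a, ha, e, he, fun j hj hja => h j (Finset.mem_erase.2 ⟨hja, hj⟩), ?_⟩
  by_contra hne
  refine hp ((propOn_iff hr).2 ⟨e, he, fun j hj => ?_⟩)
  by_cases hja : j = a
  · subst hja
    rcases prod_eq_or hr x y j with h' | h' <;> rcases he with rfl | rfl <;> simp_all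
  · exact h j (Finset.mem_erase.2 ⟨hja, hj⟩)

theorem two_le_card_of_not_adj (hr : ∀ i j, r i j = 1 ∨ r i j = -1) {x y : ι} (hW : W.Nonempty)
    (h : ¬ Adj r W x y)
    {e : ℚ} (he : e = 1 ∨ e = -1) : 2 ≤ (W.filter fun j => r x j * r y j = e).card := by
  by_contra hlt
  have hle : (W.filter fun j => r x j * r y j = e).card ≤ 1 := by omega
  obtain ⟨b, hb⟩ := hW
  have : Nonempty α := ⟨b⟩
  obtain ⟨a, ha, hsub⟩ : ∃ a ∈ W, (W.filter fun j => r x j * r y j = e) ⊆ {a} := by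
    obtain ⟨a, ha⟩ := Finset.card_le_one_iff_subset_singleton.1 hle |>.imp fun _ h => h
    by_cases haW : a ∈ W
    · exact ⟨a, haW, ha⟩
    · refine ⟨b, hb, fun j hj => ?_⟩
      have := Finset.mem_singleton.1 (ha hj)
      subst this
      exact absurd (Finset.mem_filter.1 hj).1 haW
  refine h ⟨a, ha, (propOn_iff hr).2 ⟨-e, by rcases he with rfl | rfl <;> simp, fun j hj => ?_⟩⟩
  have hne : r x j * r y j ≠ e := fun hje => (Finset.mem_erase.1 hj).1
    (Finset.mem_singleton.1 (hsub (Finset.mem_filter.2 ⟨Finset.mem_of_mem_erase hj, hje⟩)))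
  rcases prod_eq_or hr x y j with h' | h' <;> rcases he with rfl | rfl <;> simp_all

/-- Among at least four columns, three pairwise non-proportional rows are not pairwise adjacent. -/
theorem Adj.triangle_free (hr : ∀ i j, r i j = 1 ∨ r i j = -1) (hW : 4 ≤ W.card) {x y z : ι}
    (hxy : ¬ PropOn r x y W)
    (hyz : ¬ PropOn r y z W) (hxz : ¬ PropOn r x z W) (h1 : Adj r W x y) (h2 : Adj r W y z)
    (h3 : Adj r W x z) : False := by
  obtain ⟨a, ha, e, he, hae, hae'⟩ := h1.exists_sign hr hxy
  obtain ⟨b, hb, f, hf, hbf, hbf'⟩ := h2.exists_sign hr hyz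
  obtain ⟨c, hc, h, hh, hch, hch'⟩ := h3.exists_sign hr hxz
  have hprod : ∀ j, r x j * r z j = (r x j * r y j) * (r y j * r z j) := fun j => by
    linear_combination (-(r x j * r z j)) * row_sq hr y j
  obtain ⟨j, hj, hjabc⟩ : ∃ j ∈ W, j ∉ ({a, b, c} : Finset α) := by
    by_contra hcon
    push Not at hcon
    have := Finset.card_le_card (show W ⊆ {a, b, c} from hcon)
    have := Finset.card_le_three (a := a) (b := b) (c := c)
    omega
  simp only [Finset.mem_insert, Finset.mem_singleton, not_or] at hjabc
  have hef : e * f = h := by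
    rw [← hch j hj hjabc.2.2, hprod, hae j hj hjabc.1, hbf j hj hjabc.2.1]
  have hef0 : e * f ≠ 0 := by rcases he with rfl | rfl <;> rcases hf with rfl | rfl <;> norm_num
  by_cases hab : a = b
  · subst hab
    have := hprod c
    by_cases hca : c = a
    · subst hca
      rw [hch', hae', hbf', ← hef] at this
      exact hef0 (by linarith)
    · rw [hch', hae c hc hca, hbf c hc hca, ← hef] at this
      exact hef0 (by linarith)
  · by_cases hca : a = c
    · have h4 := hprod b
      rw [hch b hb (by rw [← hca]; exact Ne.symm hab), hae b hb (Ne.symm hab), hbf', ← hef] at h4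
      exact hef0 (by linarith)
    · have h4 := hprod a
      rw [hch a ha hca, hae', hbf a ha hab, ← hef] at h4
      exact hef0 (by linarith)

theorem exists_not_adj (hr : ∀ i j, r i j = 1 ∨ r i j = -1) {I : Finset ι} (hI : 3 ≤ I.card)
    (hIW : I.card < W.card)
    (h : Ind r I W) : ∃ x ∈ I, ∃ y ∈ I, x ≠ y ∧ ¬ Adj r W x y := by
  obtain ⟨x, y, z, hx, hy, hz, hxy, hxz, hyz⟩ := Finset.two_lt_card_iff.1 hI
  by_contra! hcon
  exact Adj.triangle_free hr (by omega) (h.not_propOn hx hy hxy) (h.not_propOn hy hz hyz)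
    (h.not_propOn hx hz hxz) (hcon x hx y hy hxy) (hcon y hy z hz hyz) (hcon x hx z hz hxz)

end Adjacency

section PairStep

variable {ι α : Type*} [DecidableEq ι] [Fintype α] [DecidableEq α] {r : ι → α → ℚ}

/-- The bound on `nrm` for independent families of `k` rows. -/
def NrmBound (r : ι → α → ℚ) (k : ℕ) : Prop :=
  ∀ (I : Finset ι) (W : Finset α), I.card = k → 1 ≤ k → k < W.card → Ind r I W →
    nrm W (rowProd r I) ≤ ff W.card k (k - 1)

theorem abs_row (hr : ∀ i j, r i j = 1 ∨ r i j = -1) (i : ι) (j : α) : |r i j| = 1 := by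
  rcases hr i j with h | h <;> rw [h] <;> norm_num

theorem nrm_rowProd_le_of_subset (hr : ∀ i j, r i j = 1 ∨ r i j = -1) {W : Finset α}
    {J I : Finset ι} {m : ℕ} (hJI : J ⊆ I)
    (hm : m ≤ J.card) (hIW : I.card ≤ W.card)
    (h : nrm W (rowProd r J) ≤ ff W.card J.card m) :
    nrm W (rowProd r I) ≤ ff W.card I.card m := by
  induction I using Finset.strongInduction with
  | H I ih =>
    rcases eq_or_ne J I with rfl | hne
    · exact h
    · obtain ⟨x, hxI, hxJ⟩ := Finset.exists_of_ssubset (hJI.ssubset_of_ne hne)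
      have hc := Finset.card_erase_of_mem hxI
      have hpos := Finset.card_pos.2 ⟨x, hxI⟩
      have hJ' : J ⊆ I.erase x := Finset.subset_erase.2 ⟨hJI, hxJ⟩
      have hJc := Finset.card_le_card hJ'
      have h1 := ih (I.erase x) (Finset.erase_ssubset hxI) hJ' (by omega)
      rw [rowProd_eq_lin_mul r hxI]
      refine (nrm_lin_mul_le _ (abs_row hr x) _ _).trans ?_
      rw [sum_nrm_erase W _ (I.erase x).card (cf_rowProd_eq_zero r (I.erase x))]
      have h2 : I.card = (I.erase x).card + 1 := by omega
      rw [h2, ff_succ_left _ _ _ (by omega) (by omega)]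
      refine mul_le_mul_of_nonneg_left h1 ?_
      have : ((I.erase x).card : ℚ) ≤ W.card := by exact_mod_cast (by omega)
      linarith

theorem nrm_rowProd_le_of_ind (hr : ∀ i j, r i j = 1 ∨ r i j = -1) {W : Finset α} {J I : Finset ι}
    (hb : NrmBound r J.card)
    (hJI : J ⊆ I) (hJ : 1 ≤ J.card) (hJW : J.card < W.card) (hIW : I.card ≤ W.card)
    (h : Ind r J W) : nrm W (rowProd r I) ≤ ff W.card I.card (J.card - 1) :=
  nrm_rowProd_le_of_subset hr hJI (by omega) hIW (hb J W rfl hJ hJW h)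

theorem nrm_pair_step (hr : ∀ i j, r i j = 1 ∨ r i j = -1) {K : ℕ} {I : Finset ι} {W : Finset α}
    (hb : ∀ k < K + 3, NrmBound r k)
    (hI : I.card = K + 3) (hIW : K + 3 < W.card) (hind : Ind r I W) {x y : ι} (hx : x ∈ I)
    (hy : y ∈ I) (hxy : x ≠ y) (hadj : ¬ Adj r W x y)
    (hcase : (colo r ((I.erase x).erase y) W).card = K ∨ 2 ≤ K) :
    nrm W (rowProd r I) ≤ ff W.card (K + 3) (K + 2) ∧
      (ff W.card (K + 3) (K + 2) ≤ nrm W (rowProd r I) →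
        (colo r ((I.erase x).erase y) W).card = K ∧
        ((W.filter fun j => r x j * r y j = 1).card = 2 ∨
          (W.filter fun j => r x j * r y j = -1).card = 2) ∧
        ∀ j ∈ W, j ∉ colo r ((I.erase x).erase y) W → ∀ i ∈ W,
          i ∉ colo r ((I.erase x).erase y) W → i ≠ j → r x i * r y i = r x j * r y j →
            nrm ((W.erase j).erase i) (rowProd r ((I.erase x).erase y)) =
              ff (W.card - 2) (K + 1) K) := by
  classical
  set Q := (I.erase x).erase y with hQdef
  set C := colo r Q W with hCdef
  have hyx : y ∈ I.erase x := Finset.mem_erase.2 ⟨hxy.symm, hy⟩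
  have hQI : Q ⊆ I := (Finset.erase_subset _ _).trans (Finset.erase_subset _ _)
  have hQ : Q.card = K + 1 := by
    rw [hQdef, Finset.card_erase_of_mem hyx, Finset.card_erase_of_mem hx, hI]
    omega
  have hindQ : Ind r Q W := hind.mono hQI
  have hprod : rowProd r I = lin (r x) * (lin (r y) * rowProd r Q) := by
    rw [rowProd_eq_lin_mul r hx, rowProd_eq_lin_mul r hyx]
  have hWne : W.Nonempty := Finset.card_pos.1 (by omega)
  have hQne : Q.Nonempty := Finset.card_pos.1 (by omega)
  have hcW : ∀ {j}, j ∈ W → (W.erase j).card = W.card - 1 := Finset.card_erase_of_mem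
  have hcW2 : ∀ {j i}, j ∈ W → i ∈ W.erase j → ((W.erase j).erase i).card = W.card - 2 := by
    intro j i hj hi
    rw [Finset.card_erase_of_mem hi, hcW hj]
    omega
  have hJ : ∀ j : α, ∃ i, j ∈ C → i ∈ Q ∧ Ind r (Q.erase i) (W.erase j) := by
    intro j
    by_cases hj : j ∈ C
    · obtain ⟨i, hi, h⟩ := hindQ.erase_erase hj
      exact ⟨i, fun _ => ⟨hi, h⟩⟩
    · exact ⟨x, fun h => absurd h hj⟩
  choose i₀ hi₀ using hJ
  let D : α → Finset α := fun j =>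
    if j ∈ C then colo r (Q.erase (i₀ j)) (W.erase j) else colo r Q (W.erase j)
  have hCK : C.card ≤ K := by
    have : C.card < Q.card := card_colo_lt hr hQne (by omega)
    omega
  set g : ℚ := if K = 0 then 1 else ff (W.card - 3) K (K - 1) with hgdef
  set g' : ℚ := ff (W.card - 3) K (K - 2) with hg'def
  set d : ℚ := ff (W.card - 2) (K + 1) K with hddef
  have hg : 1 ≤ K → g = ff (W.card - 3) K (K - 1) := fun h => if_neg (by omega)
  have hd0 : 0 < d := by
    have := ff_pos (K + 1) (W.card - 2) (by omega) (by omega)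
    rwa [Nat.add_sub_cancel] at this
  have hg0 : 0 < g := by
    rcases Nat.eq_zero_or_pos K with h | h
    · rw [hgdef, if_pos h]; norm_num
    · rw [hg h]
      exact ff_pos K _ h (by omega)
  have hgg : 2 ≤ K → g < g' := by
    intro hK
    have h4 := ff_succ (W.card - 3) K (K - 2)
    have hh := ff_pos (K - 1) (W.card - 4) (by omega) (by omega)
    rw [show K - 2 + 1 = K - 1 by omega, show W.card - 3 - 1 = W.card - 4 by omega] at h4
    rw [show K - 1 - 1 = K - 2 by omega] at hh
    rw [hg (by omega)]
    linarith
  have hd' : 1 ≤ K → ff (W.card - 2) (K + 1) (K - 1) = d + 2 * g := by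
    intro hK
    have h4 := ff_succ (W.card - 2) (K + 1) (K - 1)
    rw [show K - 1 + 1 = K by omega, show W.card - 2 - 1 = W.card - 3 by omega,
      Nat.add_sub_cancel] at h4
    rw [hg hK, hddef]
    linarith
  have hd'' : 2 ≤ K → ff (W.card - 2) (K + 1) (K - 2) = d + 2 * g + 2 * g' := by
    intro hK
    have h4 := ff_succ (W.card - 2) (K + 1) (K - 2)
    rw [show K - 2 + 1 = K - 1 by omega, show W.card - 2 - 1 = W.card - 3 by omega,
      Nat.add_sub_cancel, hd' (by omega)] at h4
    linarith
  have hbound : ∀ {j i : α} {J : Finset ι} {m : ℕ}, j ∈ W → i ∈ W.erase j → J ⊆ Q →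
      J.card = m + 1 → Ind r J ((W.erase j).erase i) →
      nrm ((W.erase j).erase i) (rowProd r Q) ≤ ff (W.card - 2) (K + 1) m := by
    intro j i J m hj hi hJQ hm h
    have hle := Finset.card_le_card hJQ
    have := nrm_rowProd_le_of_ind hr (hb J.card (by omega)) hJQ (by omega)
      (by rw [hcW2 hj hi]; omega) (by rw [hcW2 hj hi]; omega) h
    rwa [hcW2 hj hi, hQ, hm, Nat.add_sub_cancel] at this
  have key := sum_weights_le (W := W) (C := C) (s := fun j => r x j * r y j)
    (N := fun j i => nrm ((W.erase j).erase i) (rowProd r Q)) (D := D) (K := K) (d := d) (g := g)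
    (g' := g') (prod_eq_or hr x y) colo_subset
    (two_le_card_of_not_adj hr hWne hadj (Or.inl rfl))
    (two_le_card_of_not_adj hr hWne hadj (Or.inr rfl)) (by omega) hCK hcase hd0 hg0 hgg
    ?_ ?_ ?_ ?_
  · have htop := ff_top W.card K hIW
    have hB : ((W.card : ℚ) ^ 2 - 5 * W.card + 8) * d + 2 * K * (2 * W.card - K - 5) * g +
        2 * K * (K - 1) * g' = ff W.card (K + 3) (K + 2) := by
      rw [htop]
      rcases Nat.eq_zero_or_pos K with rfl | h
      · simp [d]
      · rw [hg h]
    have hT := nrm_pair_le (r x) (r y) (hr x) (hr y) (rowProd r Q) W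
    dsimp only at key
    rw [hB] at key
    rw [hprod]
    refine ⟨hT.trans key.1, fun h => ?_⟩
    exact key.2 (h.trans hT)
  · intro j hj hjC i hi
    have hjind := hindQ.erase hjC
    simp only [D, if_neg hjC]
    split_ifs with hiD
    · obtain ⟨q, hq, hqi⟩ := hjind.erase_erase hiD
      have h0 := card_colo_lt hr hQne (by rw [hcW hj]; omega : Q.card < (W.erase j).card)
      have := Finset.card_pos.2 ⟨i, hiD⟩
      rw [← hd' (by omega)]
      exact hbound hj hi (Finset.erase_subset _ _)
        (by rw [Finset.card_erase_of_mem hq]; omega) hqi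
    · rw [add_zero]
      exact hbound hj hi subset_rfl hQ (hjind.erase hiD)
  · intro j hj hjC
    simp only [D, if_neg hjC]
    refine ⟨fun i hi => colo_erase hi (by rintro rfl; exact hjC hi), ?_⟩
    have := card_colo_lt hr hQne (by rw [hcW hj]; omega : Q.card < (W.erase j).card)
    omega
  · intro j hjC i hi
    have hj := colo_subset hjC
    obtain ⟨hq, hqi⟩ := hi₀ j hjC
    have hK : 1 ≤ K := (Finset.card_pos.2 ⟨j, hjC⟩).trans_le hCK
    have hcq : (Q.erase (i₀ j)).card = K := by rw [Finset.card_erase_of_mem hq]; omega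
    simp only [D, if_pos hjC]
    split_ifs with hiD
    · obtain ⟨q, hq', hqi'⟩ := hqi.erase_erase hiD
      have h0 := card_colo_lt hr (Finset.card_pos.1 (by omega))
        (by rw [hcW hj]; omega : (Q.erase (i₀ j)).card < (W.erase j).card)
      have := Finset.card_pos.2 ⟨i, hiD⟩
      rw [← hd'' (by omega)]
      exact hbound hj hi ((Finset.erase_subset _ _).trans (Finset.erase_subset _ _))
        (by rw [Finset.card_erase_of_mem hq']; omega) hqi'
    · rw [add_zero, ← hd' hK]
      exact hbound hj hi (Finset.erase_subset _ _) (by omega) (hqi.erase hiD)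
  · intro j hjC
    have hj := colo_subset hjC
    obtain ⟨hq, hqi⟩ := hi₀ j hjC
    have hK : 1 ≤ K := (Finset.card_pos.2 ⟨j, hjC⟩).trans_le hCK
    have hcq : (Q.erase (i₀ j)).card = K := by rw [Finset.card_erase_of_mem hq]; omega
    simp only [D, if_pos hjC]
    have := card_colo_lt hr (Finset.card_pos.1 (by omega))
      (by rw [hcW hj]; omega : (Q.erase (i₀ j)).card < (W.erase j).card)
    omega

end PairStep

section Bound

variable {ι α : Type*} [DecidableEq ι] [Fintype α] [DecidableEq α] {r : ι → α → ℚ}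

theorem card_eq_card_add_card {s : α → ℚ} (hs : ∀ j, s j = 1 ∨ s j = -1) (W : Finset α) :
    W.card = (W.filter (s · = 1)).card + (W.filter (s · = -1)).card := by
  rw [← Finset.card_filter_add_card_filter_not (s := W) (s · = 1)]
  congr 2
  refine Finset.filter_congr fun j _ => ?_
  rcases hs j with h | h <;> rw [h] <;> norm_num

theorem sum_same_sign {s : α → ℚ} (hs : ∀ j, s j = 1 ∨ s j = -1) (W : Finset α) (c : ℚ) :
    (∑ i ∈ W, ∑ j ∈ W.erase i, if s i = s j then c else 0) =
      ((W.filter (s · = 1)).card * ((W.filter (s · = 1)).card - 1) +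
        (W.filter (s · = -1)).card * ((W.filter (s · = -1)).card - 1)) * c := by
  have h1 : ∀ i ∈ W, (∑ j ∈ W.erase i, if s i = s j then c else 0) =
      ((W.filter (s · = s i)).card - 1) * c := by
    intro i hi
    have hmem : i ∈ W.filter (s · = s i) := Finset.mem_filter.2 ⟨hi, rfl⟩
    have h2 : (W.erase i).filter (s i = s ·) = (W.filter (s · = s i)).erase i := by
      ext j
      simp only [Finset.mem_filter, Finset.mem_erase]
      tauto
    rw [← Finset.sum_filter, Finset.sum_const, nsmul_eq_mul, h2, Finset.card_erase_of_mem hmem,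
      Nat.cast_sub (Finset.card_pos.2 ⟨i, hmem⟩), Nat.cast_one]
  rw [Finset.sum_congr rfl h1]
  have := sum_part_eq (W := W) (C := ∅) hs (Finset.empty_subset _)
    (fun e => ((W.filter (s · = e)).card - 1) * c) 0
  simp only [Finset.notMem_empty, if_false] at this
  rw [this]
  simp
  ring

theorem nrm_one (W : Finset α) : nrm W 1 = 1 := by
  unfold nrm
  rw [Finset.sum_eq_single ∅]
  · simp [cf_one]
  · intro S _ hS
    simp [cf_one, hS]
  · simp

theorem rowProd_pair (r : ι → α → ℚ) {p q : ι} (h : p ≠ q) :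
    rowProd r {p, q} = lin (r p) * (lin (r q) * 1) := by
  rw [rowProd, Finset.prod_pair h, mul_one]

theorem nrm_two_rows_le_mul (hr : ∀ i j, r i j = 1 ∨ r i j = -1) {p q : ι} (hpq : p ≠ q)
    (W : Finset α) :
    nrm W (rowProd r {p, q}) ≤ W.card * (W.card - 1) := by
  have h := nrm_pair_le (r p) (r q) (hr p) (hr q) 1 W
  rw [← rowProd_pair r hpq] at h
  simp only [nrm_one] at h
  rw [sum_same_sign (prod_eq_or hr p q)] at h
  have hc := card_eq_card_add_card (prod_eq_or hr p q) W
  set u := (W.filter fun j => r p j * r q j = 1).card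
  set t := (W.filter fun j => r p j * r q j = -1).card
  rw [hc]
  push_cast
  have : (0 : ℚ) ≤ u * t := by positivity
  linarith

theorem nrm_two_rows_le (hr : ∀ i j, r i j = 1 ∨ r i j = -1) {p q : ι} (hpq : p ≠ q) {W : Finset α}
    (hp : ¬ PropOn r p q W) :
    nrm W (rowProd r {p, q}) ≤ (W.card - 1) * (W.card - 2) ∧
      ((W.card - 1) * (W.card - 2) ≤ nrm W (rowProd r {p, q}) → Adj r W p q) := by
  have h := nrm_pair_le (r p) (r q) (hr p) (hr q) 1 W
  rw [← rowProd_pair r hpq] at h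
  simp only [nrm_one] at h
  rw [sum_same_sign (prod_eq_or hr p q)] at h
  have hc := card_eq_card_add_card (prod_eq_or hr p q) W
  have hpos : ∀ e : ℚ, (e = 1 ∨ e = -1) → 1 ≤ (W.filter fun j => r p j * r q j = e).card := by
    intro e he
    by_contra hlt
    have h0 : (W.filter fun j => r p j * r q j = e) = ∅ := Finset.card_eq_zero.1 (by omega)
    refine hp ((propOn_iff hr).2 ⟨-e, by rcases he with rfl | rfl <;> simp, fun j hj => ?_⟩)
    have : r p j * r q j ≠ e := fun hje => by
      have : j ∈ W.filter fun j => r p j * r q j = e := Finset.mem_filter.2 ⟨hj, hje⟩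
      rw [h0] at this
      simp at this
    rcases prod_eq_or hr p q j with h' | h' <;> rcases he with rfl | rfl <;> simp_all
  have hu := hpos 1 (Or.inl rfl)
  have ht := hpos (-1) (Or.inr rfl)
  have hadj : ¬ Adj r W p q → 2 ≤ (W.filter fun j => r p j * r q j = 1).card ∧
      2 ≤ (W.filter fun j => r p j * r q j = -1).card := fun hna =>
    have hne : W.Nonempty := Finset.card_pos.1 (by omega)
    ⟨two_le_card_of_not_adj hr hne hna (Or.inl rfl),
      two_le_card_of_not_adj hr hne hna (Or.inr rfl)⟩
  set u := (W.filter fun j => r p j * r q j = 1).card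
  set t := (W.filter fun j => r p j * r q j = -1).card
  rw [hc]
  push_cast
  have hu' : (1 : ℚ) ≤ u := by exact_mod_cast hu
  have ht' : (1 : ℚ) ≤ t := by exact_mod_cast ht
  refine ⟨by nlinarith, fun hle => ?_⟩
  by_contra hna
  obtain ⟨h2, h3⟩ := hadj hna
  have h2' : (2 : ℚ) ≤ u := by exact_mod_cast h2
  have h3' : (2 : ℚ) ≤ t := by exact_mod_cast h3
  nlinarith

/-- The exceptional pairs of columns: the rows `p` and `q` become proportional after the removal
of at most one pair of columns. -/
theorem exists_exceptional_pair (hr : ∀ i j, r i j = 1 ∨ r i j = -1) {p q : ι} {W : Finset α}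
    (hW : 5 ≤ W.card)
    (hna : ¬ Adj r W p q) : ∃ S : Finset α, S.card ≤ 2 ∧ ∀ i j,
      PropOn r p q ((W.erase j).erase i) → j ∈ S ∧ i ∈ S := by
  have hne : W.Nonempty := Finset.card_pos.1 (by omega)
  have hc := card_eq_card_add_card (prod_eq_or hr p q) W
  obtain ⟨e, he, hlarge⟩ : ∃ e : ℚ, (e = 1 ∨ e = -1) ∧
      3 ≤ (W.filter fun j => r p j * r q j = e).card := by
    by_contra! hcon
    have h1 := hcon 1 (Or.inl rfl)
    have h2 := hcon (-1) (Or.inr rfl)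
    omega
  have he' : -e = 1 ∨ -e = -1 := by rcases he with rfl | rfl <;> simp
  have h2 := two_le_card_of_not_adj hr hne hna he'
  have key : ∀ i j, PropOn r p q ((W.erase j).erase i) →
      (W.filter fun j => r p j * r q j = -e) ⊆ {j, i} := by
    intro i j hp
    obtain ⟨f, hf, hpf⟩ := (propOn_iff hr).1 hp
    have hsub : ∀ e', e' ≠ f → (W.filter fun j => r p j * r q j = e') ⊆ {j, i} := by
      intro e' hne l hl
      obtain ⟨hlW, hl⟩ := Finset.mem_filter.1 hl
      by_contra hcon
      simp only [Finset.mem_insert, Finset.mem_singleton, not_or] at hcon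
      refine hne ?_
      rw [← hl, hpf l (by simp only [Finset.mem_erase]; tauto)]
    by_cases hef : e = f
    · refine hsub (-e) ?_
      rw [← hef]
      rcases he with rfl | rfl <;> norm_num
    · have := Finset.card_le_card (hsub e hef)
      have := Finset.card_le_two (a := j) (b := i)
      omega
  by_cases hcard : (W.filter fun j => r p j * r q j = -e).card = 2
  · refine ⟨_, hcard.le, fun i j hp => ?_⟩
    rw [Finset.eq_of_subset_of_card_le (key i j hp) (by rw [hcard]; exact Finset.card_le_two)]
    simp
  · refine ⟨∅, by simp, fun i j hp => ?_⟩
    have := Finset.card_le_card (key i j hp)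
    have := Finset.card_le_two (a := j) (b := i)
    omega

theorem nrm_four_rows_lt (hr : ∀ i j, r i j = 1 ∨ r i j = -1) {W : Finset α} {x y p q : ι}
    {I : Finset ι} (hx : x ∈ I) (hy : y ∈ I)
    (hxy : x ≠ y) (hQ : (I.erase x).erase y = {p, q}) (hpq : p ≠ q) (hW : 5 ≤ W.card)
    (hxyn : ¬ Adj r W x y) (hpqn : ¬ Adj r W p q) : nrm W (rowProd r I) < ff W.card 4 3 := by
  have hne : W.Nonempty := Finset.card_pos.1 (by omega)
  obtain ⟨S, hS, hexc⟩ := exists_exceptional_pair hr hW hpqn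
  have hyx : y ∈ I.erase x := Finset.mem_erase.2 ⟨hxy.symm, hy⟩
  have hn : (5 : ℚ) ≤ W.card := by exact_mod_cast hW
  set n : ℚ := (W.card : ℚ) with hndef
  have hprod : rowProd r I = lin (r x) * (lin (r y) * rowProd r {p, q}) := by
    rw [rowProd_eq_lin_mul r hx, rowProd_eq_lin_mul r hyx, hQ]
  have hb : ∀ j ∈ W, ∀ i ∈ W.erase j, nrm ((W.erase j).erase i) (rowProd r {p, q}) ≤
      (n - 3) * (n - 4) + if j ∈ S ∧ i ∈ S then 2 * (n - 3) else 0 := by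
    intro j hj i hi
    have hc : (((W.erase j).erase i).card : ℚ) = n - 2 := by
      rw [Finset.card_erase_of_mem hi, Finset.card_erase_of_mem hj,
        show W.card - 1 - 1 = W.card - 2 by omega, Nat.cast_sub (by omega)]
      norm_num [hndef]
    split_ifs with hji
    · refine (nrm_two_rows_le_mul hr hpq _).trans (le_of_eq ?_)
      rw [hc]
      ring
    · refine (nrm_two_rows_le hr hpq fun h => hji (hexc i j h)).1.trans (le_of_eq ?_)
      rw [hc]
      ring
  have hT := nrm_pair_le (r x) (r y) (hr x) (hr y) (rowProd r {p, q}) W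
  rw [← hprod] at hT
  have hsplit : (∑ j ∈ W, ∑ i ∈ W.erase j, if r x j * r y j = r x i * r y i then
      nrm ((W.erase j).erase i) (rowProd r {p, q}) else 0) ≤
      (∑ j ∈ W, ∑ i ∈ W.erase j, if r x j * r y j = r x i * r y i then (n - 3) * (n - 4) else 0) +
      ∑ j ∈ W, ∑ i ∈ W.erase j, if j ∈ S ∧ i ∈ S then 2 * (n - 3) else 0 := by
    rw [← Finset.sum_add_distrib]
    refine Finset.sum_le_sum fun j hj => ?_
    rw [← Finset.sum_add_distrib]
    refine Finset.sum_le_sum fun i hi => ?_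
    by_cases h : r x j * r y j = r x i * r y i
    · rw [if_pos h, if_pos h]
      exact hb j hj i hi
    · rw [if_neg h, if_neg h, zero_add]
      split_ifs
      · linarith
      · exact le_rfl
  have hexcsum : (∑ j ∈ W, ∑ i ∈ W.erase j, if j ∈ S ∧ i ∈ S then 2 * (n - 3) else 0) ≤
      2 * (2 * (n - 3)) := by
    have h1 : ∀ j ∈ W, (∑ i ∈ W.erase j, if j ∈ S ∧ i ∈ S then 2 * (n - 3) else 0) ≤
        if j ∈ S then 2 * (n - 3) else 0 := by
      intro j _
      by_cases hj : j ∈ S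
      · simp only [hj, true_and, if_true]
        rw [Finset.sum_ite_mem, Finset.sum_const, nsmul_eq_mul]
        refine mul_le_of_le_one_left (by linarith) ?_
        have h2 : W.erase j ∩ S ⊆ S.erase j := by
          intro i
          simp only [Finset.mem_inter, Finset.mem_erase]
          tauto
        have h3 := Finset.card_le_card h2
        rw [Finset.card_erase_of_mem hj] at h3
        exact_mod_cast (by omega : (W.erase j ∩ S).card ≤ 1)
      · simp [hj]
    refine (Finset.sum_le_sum h1).trans ?_
    rw [Finset.sum_ite_mem, Finset.sum_const, nsmul_eq_mul]
    refine mul_le_mul_of_nonneg_right ?_ (by linarith)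
    have := Finset.card_le_card (Finset.inter_subset_right : W ∩ S ⊆ S)
    exact_mod_cast (by omega : (W ∩ S).card ≤ 2)
  rw [sum_same_sign (prod_eq_or hr x y)] at hsplit
  have htop := ff_top W.card 1 (by omega)
  have hd := ff_two (W.card - 2) (by omega)
  have hg := ff_one (W.card - 3)
  rw [Nat.cast_sub (by omega)] at hd hg
  rw [hd, hg] at htop
  have hc := card_eq_card_add_card (prod_eq_or hr x y) W
  have hu := two_le_card_of_not_adj hr hne hxyn (Or.inl rfl)
  have ht := two_le_card_of_not_adj hr hne hxyn (Or.inr rfl)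
  set u := (W.filter fun j => r x j * r y j = 1).card
  set t := (W.filter fun j => r x j * r y j = -1).card
  have hc' : n = u + t := by rw [hndef, hc]; push_cast; ring
  have hu' : (2 : ℚ) ≤ u := by exact_mod_cast hu
  have ht' : (2 : ℚ) ≤ t := by exact_mod_cast ht
  have hut : (0 : ℚ) ≤ (u - 2) * (t - 2) := mul_nonneg (by linarith) (by linarith)
  have h34 : 0 ≤ (n - 3) * (n - 4) := mul_nonneg (by linarith) (by linarith)
  have hle : (u * (u - 1) + t * (t - 1) : ℚ) * ((n - 3) * (n - 4)) ≤
      (n ^ 2 - 5 * n + 8) * ((n - 3) * (n - 4)) := by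
    refine mul_le_mul_of_nonneg_right ?_ h34
    rw [hc']
    nlinarith
  have hlast : 2 * (2 * (n - 3)) < 4 * (n - 3) * (n - 3) := by nlinarith
  norm_num at htop
  rw [htop]
  refine lt_of_le_of_lt (hT.trans (hsplit.trans (add_le_add hle hexcsum))) ?_
  rw [← hndef]
  nlinarith

theorem exists_coloop_of_adj {p q : ι} {Q : Finset ι} {W : Finset α} (hpQ : p ∈ Q) (hqQ : q ∈ Q)
    (hpq : p ≠ q) (hp : ¬ PropOn r p q W) (h : Adj r W p q) : (colo r Q W).Nonempty := by
  obtain ⟨a, ha, l, hl⟩ := h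
  have hsum : ∀ j, ∑ i ∈ Q, (if i = p then 1 else if i = q then -l else 0) * r i j =
      r p j - l * r q j := by
    intro j
    rw [← Finset.add_sum_erase _ _ hpQ, ← Finset.add_sum_erase _ _
      (Finset.mem_erase.2 ⟨hpq.symm, hqQ⟩), Finset.sum_eq_zero]
    · simp [hpq.symm]
      ring
    · intro i hi
      simp only [Finset.mem_erase] at hi
      simp [hi.1, hi.2.1]
  refine ⟨a, mem_colo.2 ⟨ha, fun i => if i = p then 1 else if i = q then -l else 0, ?_, ?_⟩⟩
  · rw [hsum]
    intro h0
    refine hp ⟨l, fun j hj => ?_⟩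
    by_cases hja : j = a
    · subst hja
      linarith
    · exact hl j (Finset.mem_erase.2 ⟨hja, hj⟩)
  · intro j hj
    rw [hsum, hl j hj, sub_self]

/-- The main bound, for an arbitrary set of independent rows and arbitrary columns. -/
theorem nrmBound (hr : ∀ i j, r i j = 1 ∨ r i j = -1) (k : ℕ) : NrmBound r k := by
  induction k using Nat.strong_induction_on with
  | _ k ih =>
    intro I W hI hk hkW hind
    match k, hk with
    | 1, _ =>
      obtain ⟨x, rfl⟩ := Finset.card_eq_one.1 hI
      have h := nrm_lin_mul_le (r x) (abs_row hr x) W 1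
      simp only [nrm_one, mul_one, Finset.sum_const, nsmul_eq_mul] at h
      rw [Nat.sub_self, ff_one, rowProd, Finset.prod_singleton]
      exact h
    | 2, _ =>
      obtain ⟨p, q, hpq, rfl⟩ := Finset.card_eq_two.1 hI
      rw [show 2 - 1 = 1 from rfl, ff_two _ hkW.le]
      exact (nrm_two_rows_le hr hpq (hind.not_propOn (by simp) (by simp) hpq)).1
    | K + 3, _ =>
      obtain ⟨x, hx, y, hy, hxy, hna⟩ := exists_not_adj hr (by omega) (by omega) hind
      have hyx : y ∈ I.erase x := Finset.mem_erase.2 ⟨hxy.symm, hy⟩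
      have hQI : (I.erase x).erase y ⊆ I :=
        (Finset.erase_subset _ _).trans (Finset.erase_subset _ _)
      have hQ : ((I.erase x).erase y).card = K + 1 := by
        rw [Finset.card_erase_of_mem hyx, Finset.card_erase_of_mem hx, hI]
        omega
      have hcK := card_colo_lt hr (Finset.card_pos.1 (by omega))
        (by omega : ((I.erase x).erase y).card < W.card)
      by_cases hcase : (colo r ((I.erase x).erase y) W).card = K ∨ 2 ≤ K
      · exact (nrm_pair_step hr ih hI hkW hind hx hy hxy hna hcase).1
      · obtain ⟨rfl, hc0⟩ : K = 1 ∧ (colo r ((I.erase x).erase y) W).card = 0 := by omega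
        obtain ⟨p, q, hpq, hpqQ⟩ := Finset.card_eq_two.1 hQ
        have hpQ : p ∈ (I.erase x).erase y := by rw [hpqQ]; simp
        have hqQ : q ∈ (I.erase x).erase y := by rw [hpqQ]; simp
        refine (nrm_four_rows_lt hr hx hy hxy hpqQ hpq hkW hna fun hadj => ?_).le
        have := Finset.card_pos.2 (exists_coloop_of_adj hpQ hqQ hpq
          (hind.not_propOn (hQI hpQ) (hQI hqQ) hpq) hadj)
        omega

end Bound

section Stars

variable {ι : Type*} [DecidableEq ι]

/-- A triangle-free graph on at least five vertices, in which any two non-adjacent vertices have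
at most two common neighbours and a star as complement, is a star as soon as it is not
complete. -/
theorem exists_star_center {I : Finset ι} {R : ι → ι → Prop} (hI : 5 ≤ I.card)
    (hsymm : ∀ x y, R x y → R y x)
    (htri : ∀ x ∈ I, ∀ y ∈ I, ∀ z ∈ I, x ≠ y → y ≠ z → x ≠ z → R x y → R y z → R x z → False)
    (hstar : ∀ x ∈ I, ∀ y ∈ I, x ≠ y → ¬ R x y →
      ∃ z ∈ (I.erase x).erase y, ∀ p ∈ (I.erase x).erase y, p ≠ z → R z p)
    (hcom : ∀ x ∈ I, ∀ y ∈ I, x ≠ y → ¬ R x y → ∀ p ∈ I, ∀ q ∈ I, ∀ w ∈ I,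
      p ≠ q → p ≠ w → q ≠ w → R p x → R p y → R q x → R q y → R w x → R w y → False)
    {x y : ι} (hx : x ∈ I) (hy : y ∈ I) (hxy : x ≠ y) (hn : ¬ R x y) :
    ∃ z ∈ I, ∀ p ∈ I, p ≠ z → R z p := by
  have hstar' : ∀ x ∈ I, ∀ y ∈ I, x ≠ y → ¬ R x y →
      ∃ z ∈ I, z ≠ x ∧ z ≠ y ∧ ∀ p ∈ I, p ≠ x → p ≠ y → p ≠ z → R z p := by
    intro x hx y hy hxy hn
    obtain ⟨z, hz, h⟩ := hstar x hx y hy hxy hn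
    simp only [Finset.mem_erase] at hz h
    exact ⟨z, hz.2.2, hz.2.1, hz.1, fun p hp h1 h2 h3 => h p ⟨h2, h1, hp⟩ h3⟩
  obtain ⟨z, hz, hzx, hzy, hzc⟩ := hstar' x hx y hy hxy hn
  obtain ⟨p, hp, q, hq, hpq⟩ : ∃ p ∈ ((I.erase x).erase y).erase z,
      ∃ q ∈ ((I.erase x).erase y).erase z, p ≠ q := by
    refine Finset.one_lt_card.1 ?_
    have h1 := Finset.pred_card_le_card_erase (s := I) (a := x)
    have h2 := Finset.pred_card_le_card_erase (s := I.erase x) (a := y)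
    have h3 := Finset.pred_card_le_card_erase (s := (I.erase x).erase y) (a := z)
    omega
  simp only [Finset.mem_erase] at hp hq
  obtain ⟨hpz, hpy, hpx, hp⟩ := hp
  obtain ⟨hqz, hqy, hqx, hq⟩ := hq
  have hzp := hzc p hp hpx hpy hpz
  have hzq := hzc q hq hqx hqy hqz
  have hnpq : ¬ R p q := fun h => htri z hz p hp q hq hpz.symm hpq hqz.symm hzp h hzq
  obtain ⟨w, hw, hwp, hwq, hwc⟩ := hstar' p hp q hq hpq hnpq
  by_cases hwz : w = z
  · subst hwz
    refine ⟨w, hw, fun m hm hmw => ?_⟩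
    by_cases hmp : m = p
    · rwa [hmp]
    · by_cases hmq : m = q
      · rwa [hmq]
      · exact hwc m hm hmp hmq hmw
  exfalso
  have hwx : w ≠ x := by
    rintro rfl
    exact hn (hwc y hy hpy.symm hqy.symm hxy.symm)
  have hwy : w ≠ y := by
    rintro rfl
    exact hn (hsymm _ _ (hwc x hx hpx.symm hqx.symm hxy))
  have hRwx := hwc x hx hpx.symm hqx.symm hwx.symm
  have hRwy := hwc y hy hpy.symm hqy.symm hwy.symm
  have hRzw := hzc w hw hwx hwy hwz
  have key : ∀ p ∈ I, p ≠ x → p ≠ y → p ≠ z → w ≠ p →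
      ∃ v ∈ I, v ≠ p ∧ v ≠ w ∧ v ≠ z ∧ R v x ∧ R v y ∧
        ∀ m ∈ I, m ≠ p → m ≠ w → m ≠ v → R v m := by
    intro p hp hpx hpy hpz hwp
    have hnpw : ¬ R p w := fun h =>
      htri z hz p hp w hw hpz.symm hwp.symm (Ne.symm hwz) (hzc p hp hpx hpy hpz) h hRzw
    obtain ⟨v, hv, hvp, hvw, hvc⟩ := hstar' p hp w hw hwp.symm hnpw
    have hvx : v ≠ x := by
      rintro rfl
      exact hn (hvc y hy hpy.symm hwy.symm hxy.symm)
    have hvy : v ≠ y := by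
      rintro rfl
      exact hn (hsymm _ _ (hvc x hx hpx.symm hwx.symm hxy))
    have hRvx := hvc x hx hpx.symm hwx.symm hvx.symm
    refine ⟨v, hv, hvp, hvw, ?_, hRvx, hvc y hy hpy.symm hwy.symm hvy.symm, hvc⟩
    rintro rfl
    exact htri v hz w hw x hx hvw hwx hzx hRzw hRwx hRvx
  obtain ⟨v, hv, hvp, hvw, hvz, hvx, hvy, hvc⟩ := key p hp hpx hpy hpz hwp
  obtain ⟨v', hv', hvq', hvw', -, hvx', hvy', -⟩ := key q hq hqx hqy hqz hwq
  by_cases hvv : v = v'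
  · subst hvv
    exact htri v hv z hz q hq hvz hqz.symm hvq' (hvc z hz hpz.symm (Ne.symm hwz) hvz.symm) hzq
      (hvc q hq hpq.symm hwq.symm hvq'.symm)
  · exact hcom x hx y hy hxy hn w hw v hv v' hv' hvw.symm hvw'.symm hvv hRwx hRwy hvx hvy hvx' hvy'

end Stars

section StarCenter

variable {ι α : Type*} [DecidableEq ι] [Fintype α] [DecidableEq α] {r : ι → α → ℚ}

/-- Some row of `I` is adjacent to all the other rows of `I`. -/
def RowStar (r : ι → α → ℚ) (I : Finset ι) (W : Finset α) : Prop :=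
  ∃ z ∈ I, ∀ p ∈ I, p ≠ z → Adj r W z p

theorem Adj.common (hr : ∀ i j, r i j = 1 ∨ r i j = -1) {W : Finset α} (hW : 5 ≤ W.card) {x y p : ι}
    (hxy : ¬ PropOn r x y W)
    (hpx : ¬ PropOn r p x W) (hpy : ¬ PropOn r p y W) (h1 : Adj r W p x) (h2 : Adj r W p y) :
    ∃ a ∈ W, ∃ e : ℚ, (e = 1 ∨ e = -1) ∧ r x a * r y a = -e ∧ PropOn r p x (W.erase a) ∧
      (W.filter fun j => r x j * r y j = -e).card = 2 ∧
      3 ≤ (W.filter fun j => r x j * r y j = e).card := by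
  obtain ⟨a, ha, e, he, hae, hae'⟩ := h1.exists_sign hr hpx
  obtain ⟨b, hb, f, hf, hbf, hbf'⟩ := h2.exists_sign hr hpy
  have hprod : ∀ j, r x j * r y j = (r p j * r x j) * (r p j * r y j) := fun j => by
    linear_combination (-(r x j * r y j)) * row_sq hr p j
  have hef : e * f = 1 ∨ e * f = -1 := by
    rcases he with rfl | rfl <;> rcases hf with rfl | rfl <;> norm_num
  have hne : -(e * f) ≠ e * f := by rcases hef with h | h <;> rw [h] <;> norm_num
  have hout : ∀ j ∈ W, j ≠ a → j ≠ b → r x j * r y j = e * f := fun j hj h h' => by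
    rw [hprod, hae j hj h, hbf j hj h']
  have hab : a ≠ b := by
    rintro rfl
    refine hxy ((propOn_iff hr).2 ⟨e * f, hef, fun j hj => ?_⟩)
    by_cases hja : j = a
    · subst hja
      rw [hprod, hae', hbf']
      ring
    · exact hout j hj hja hja
  have haa : r x a * r y a = -(e * f) := by rw [hprod, hae', hbf a ha hab]; ring
  have hbb : r x b * r y b = -(e * f) := by rw [hprod, hae b hb hab.symm, hbf']; ring
  have hpart : (W.filter fun j => r x j * r y j = -(e * f)) = {a, b} := by
    ext j
    simp only [Finset.mem_filter, Finset.mem_insert, Finset.mem_singleton]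
    constructor
    · rintro ⟨hj, h⟩
      by_contra! hcon
      rw [hout j hj hcon.1 hcon.2] at h
      exact hne h.symm
    · rintro (rfl | rfl)
      · exact ⟨ha, haa⟩
      · exact ⟨hb, hbb⟩
  have hc2 : (W.filter fun j => r x j * r y j = -(e * f)).card = 2 := by
    rw [hpart, Finset.card_pair hab]
  refine ⟨a, ha, e * f, hef, haa, (propOn_iff hr).2 ⟨e, he, fun j hj => ?_⟩, hc2, ?_⟩
  · exact hae j (Finset.mem_of_mem_erase hj) (Finset.ne_of_mem_erase hj)
  · have hc := card_eq_card_add_card (prod_eq_or hr x y) W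
    rcases hef with h | h <;> rw [h] at hc2 ⊢
    · omega
    · rw [neg_neg] at hc2
      omega

theorem not_propOn_triple (hr : ∀ i j, r i j = 1 ∨ r i j = -1) {W : Finset α} (hW : 5 ≤ W.card)
    {x y : ι} {T : Finset ι}
    (hT : T.card = 3) (hxy : ¬ PropOn r x y W) (hTT : ∀ p ∈ T, ∀ q ∈ T, p ≠ q → ¬ PropOn r p q W)
    (hpx : ∀ p ∈ T, ¬ PropOn r p x W ∧ Adj r W p x)
    (hpy : ∀ p ∈ T, ¬ PropOn r p y W ∧ Adj r W p y) : False := by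
  have key := fun p hp => Adj.common hr hW hxy (hpx p hp).1 (hpy p hp).1 (hpx p hp).2 (hpy p hp).2
  obtain ⟨p₀, hp₀⟩ := Finset.card_pos.1 (by omega : 0 < T.card)
  obtain ⟨-, -, e, he, -, -, h2, h3⟩ := key p₀ hp₀
  have key' : ∀ p ∈ T, ∃ a ∈ W.filter (fun j => r x j * r y j = -e), PropOn r p x (W.erase a) := by
    intro p hp
    obtain ⟨a, ha, f, hf, hfa, hpa, hf2, -⟩ := key p hp
    have hfe : f = e := by
      by_contra hne
      have : -f = e := by
        rcases he with rfl | rfl <;> rcases hf with rfl | rfl <;> simp_all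
      rw [this] at hf2
      omega
    exact ⟨a, Finset.mem_filter.2 ⟨ha, by rw [← hfe]; exact hfa⟩, hpa⟩
  have : Nonempty α := (Finset.card_pos.1 (by omega : 0 < W.card)).to_type
  choose! a ha hpa using key'
  obtain ⟨p, hp, q, hq, hpq, hapq⟩ :=
    Finset.exists_ne_map_eq_of_card_lt_of_maps_to (by rw [h2, hT]; norm_num) ha
  obtain ⟨m, hm, e', he', hme, hme'⟩ := (hpx p hp).2.exists_sign hr (hpx p hp).1
  obtain ⟨m', hm', f', hf', hmf, hmf'⟩ := (hpx q hq).2.exists_sign hr (hpx q hq).1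
  have huniq : ∀ {p : ι} {a m : α} {e : ℚ}, m ∈ W → (e = 1 ∨ e = -1) →
      PropOn r p x (W.erase a) → (∀ j ∈ W, j ≠ m → r p j * r x j = e) →
      r p m * r x m = -e → a = m := by
    intro p a m e hm he hp hout hin
    by_contra hne
    obtain ⟨l, -, hl⟩ := (propOn_iff hr).1 hp
    obtain ⟨j, hj, hjam⟩ : ∃ j ∈ W, j ∉ ({a, m} : Finset α) := by
      by_contra! hcon
      have := Finset.card_le_card (show W ⊆ {a, m} from hcon)
      have := Finset.card_le_two (a := a) (b := m)
      omega
    simp only [Finset.mem_insert, Finset.mem_singleton, not_or] at hjam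
    have h1 := hl j (Finset.mem_erase.2 ⟨hjam.1, hj⟩)
    have h2 := hl m (Finset.mem_erase.2 ⟨Ne.symm hne, hm⟩)
    rw [hout j hj hjam.2] at h1
    rw [hin] at h2
    rcases he with rfl | rfl <;> linarith
  have e1 := huniq hm he' (hpa p hp) hme hme'
  have e2 := huniq hm' hf' (hpa q hq) hmf hmf'
  have emm : m = m' := by rw [← e1, ← e2, hapq]
  subst emm
  refine hTT p hp q hq hpq ((propOn_iff hr).2 ⟨e' * f', ?_, fun j hj => ?_⟩)
  · rcases he' with rfl | rfl <;> rcases hf' with rfl | rfl <;> norm_num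
  · have : r p j * r q j = (r p j * r x j) * (r q j * r x j) := by
      linear_combination (-(r p j * r q j)) * row_sq hr x j
    rw [this]
    by_cases hjm : j = m
    · rw [hjm, hme', hmf']
      ring
    · rw [hme j hj hjm, hmf j hj hjm]

/-- Three pairwise non-proportional rows that are proportional off two columns form a star. -/
theorem star_of_card_three (hr : ∀ i j, r i j = 1 ∨ r i j = -1) {W C : Finset α} {Q : Finset ι}
    (hQ : Q.card = 3) (hCW : C ⊆ W)
    (hC : C.card = 2) (hp : ∀ x ∈ Q, ∀ y ∈ Q, PropOn r x y (W \ C))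
    (hn : ∀ x ∈ Q, ∀ y ∈ Q, x ≠ y → ¬ PropOn r x y W) : RowStar r Q W := by
  obtain ⟨a, b, hab, rfl⟩ := Finset.card_eq_two.1 hC
  have haW : a ∈ W := hCW (by simp)
  have hbW : b ∈ W := hCW (by simp)
  have hflip : ∀ x ∈ Q, ∀ y ∈ Q, ¬ Adj r W x y → ∃ e : ℚ, (e = 1 ∨ e = -1) ∧
      ∀ j ∈ W, r x j * r y j = if j = a ∨ j = b then -e else e := by
    intro x hx y hy hna
    obtain ⟨e, he, h⟩ := (propOn_iff hr).1 (hp x hx y hy)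
    have hother : ∀ c d, c ∈ W → d ∈ W → (∀ j ∈ W, j ≠ c → j ≠ d → r x j * r y j = e) →
        r x c * r y c = -e := by
      intro c d hc hd hcd
      by_contra hne
      have hce : r x c * r y c = e := by
        rcases prod_eq_or hr x y c with h' | h' <;> rcases he with rfl | rfl <;> simp_all
      refine hna ⟨d, hd, (propOn_iff hr).2 ⟨e, he, fun j hj => ?_⟩⟩
      by_cases hjc : j = c
      · rw [hjc, hce]
      · exact hcd j (Finset.mem_of_mem_erase hj) hjc (Finset.ne_of_mem_erase hj)
    have hout : ∀ j ∈ W, j ≠ a → j ≠ b → r x j * r y j = e := fun j hj h1 h2 =>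
      h j (by simp [hj, h1, h2])
    refine ⟨e, he, fun j hj => ?_⟩
    split_ifs with hjab
    · rcases hjab with rfl | rfl
      · exact hother j b hj hbW hout
      · exact hother j a hj haW fun i hi h1 h2 => hout i hi h2 h1
    · push Not at hjab
      exact hout j hj hjab.1 hjab.2
  have hnot : ∀ x ∈ Q, ∀ y ∈ Q, ∀ z ∈ Q, y ≠ z → ¬ Adj r W x y → ¬ Adj r W x z → False := by
    intro x hx y hy z hz hyz h1 h2
    obtain ⟨e, he, h1⟩ := hflip x hx y hy h1
    obtain ⟨f, hf, h2⟩ := hflip x hx z hz h2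
    refine hn y hy z hz hyz ((propOn_iff hr).2 ⟨e * f, ?_, fun j hj => ?_⟩)
    · rcases he with rfl | rfl <;> rcases hf with rfl | rfl <;> norm_num
    · have : r y j * r z j = (r x j * r y j) * (r x j * r z j) := by
        linear_combination (-(r y j * r z j)) * row_sq hr x j
      rw [this, h1 j hj, h2 j hj]
      split_ifs <;> ring
  obtain ⟨x, y, z, hxy, hxz, hyz, rfl⟩ := Finset.card_eq_three.1 hQ
  have hx : x ∈ ({x, y, z} : Finset ι) := by simp
  have hy : y ∈ ({x, y, z} : Finset ι) := by simp
  have hz : z ∈ ({x, y, z} : Finset ι) := by simp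
  by_cases h1 : Adj r W x y
  · by_cases h2 : Adj r W x z
    · refine ⟨x, hx, fun p hp hpx => ?_⟩
      simp only [Finset.mem_insert, Finset.mem_singleton] at hp
      rcases hp with rfl | rfl | rfl
      · exact absurd rfl hpx
      · exact h1
      · exact h2
    · refine ⟨y, hy, fun p hp hpy => ?_⟩
      simp only [Finset.mem_insert, Finset.mem_singleton] at hp
      rcases hp with rfl | rfl | rfl
      · exact h1.symm hr
      · exact absurd rfl hpy
      · by_contra h3
        exact hnot _ hz _ hx _ hy hxy (fun h => h2 (h.symm hr)) (fun h => h3 (h.symm hr))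
  · refine ⟨z, hz, fun p hp hpz => ?_⟩
    simp only [Finset.mem_insert, Finset.mem_singleton] at hp
    rcases hp with rfl | rfl | rfl
    · by_contra h3
      exact hnot _ hx _ hy _ hz hyz h1 (fun h => h3 (h.symm hr))
    · by_contra h3
      exact hnot _ hy _ hx _ hz hxz (fun h => h1 (h.symm hr)) (fun h => h3 (h.symm hr))
    · exact absurd rfl hpz

theorem RowStar.of_erase (hr : ∀ i j, r i j = 1 ∨ r i j = -1) {W C : Finset α} {Q : Finset ι}
    {i j : α} (hCW : C ⊆ W)
    (hC : C.card + 4 ≤ W.card) (hi : i ∉ C) (hj : j ∉ C)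
    (hp : ∀ x ∈ Q, ∀ y ∈ Q, PropOn r x y (W \ C)) (h : RowStar r Q ((W.erase j).erase i)) :
    RowStar r Q W := by
  obtain ⟨z, hz, h⟩ := h
  refine ⟨z, hz, fun p hpQ hpz => ?_⟩
  obtain ⟨a, ha, l, hl⟩ := h p hpQ hpz
  obtain ⟨l', hl'⟩ := hp z hz p hpQ
  obtain ⟨m, hm, hmn⟩ : ∃ m ∈ W \ C, m ∉ ({i, j, a} : Finset α) := by
    by_contra! hcon
    have h1 := Finset.card_le_card (show W \ C ⊆ {i, j, a} from hcon)
    have h2 := Finset.card_le_three (a := i) (b := j) (c := a)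
    rw [Finset.card_sdiff_of_subset hCW] at h1
    omega
  simp only [Finset.mem_insert, Finset.mem_singleton, not_or] at hmn
  have hmem : ∀ m ∈ W, m ≠ i → m ≠ j → m ≠ a → m ∈ ((W.erase j).erase i).erase a := by
    intro m hm h1 h2 h3
    simp only [Finset.mem_erase]
    tauto
  have hll : l = l' := by
    have h1 := hl m (hmem m (Finset.mem_sdiff.1 hm).1 hmn.1 hmn.2.1 hmn.2.2)
    rw [hl' m hm] at h1
    have h2 : (l' - l) * r p m = 0 := by linarith
    rcases mul_eq_zero.1 h2 with h3 | h3
    · linarith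
    · rcases hr p m with h4 | h4 <;> rw [h4] at h3 <;> norm_num at h3
  refine ⟨a, Finset.mem_of_mem_erase (Finset.mem_of_mem_erase ha), l, fun m hm => ?_⟩
  obtain ⟨hma, hmW⟩ := Finset.mem_erase.1 hm
  by_cases hmi : m = i
  · rw [hll]
    exact hl' m (Finset.mem_sdiff.2 ⟨hmW, by rwa [hmi]⟩)
  · by_cases hmj : m = j
    · rw [hll]
      exact hl' m (Finset.mem_sdiff.2 ⟨hmW, by rwa [hmj]⟩)
    · exact hl m (hmem m hmW hmi hmj hma)

end StarCenter

section SmallCases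

variable {ι α : Type*} [DecidableEq ι] [Fintype α] [DecidableEq α] {r : ι → α → ℚ}

theorem cf_lin_singleton (v : α → ℚ) (j : α) : cf (lin v * 1) {j} = v j := by
  rw [cf_lin_mul, Finset.sum_singleton, cf_one, if_pos (by simp), mul_one]

theorem cf_three (u v w : α → ℚ) {i j l : α} (hij : i ≠ j) (hil : i ≠ l) (hjl : j ≠ l) :
    cf (lin u * (lin v * (lin w * 1))) {i, j, l} =
      u i * (v j * w l + v l * w j) + u j * (v i * w l + v l * w i) +
        u l * (v i * w j + v j * w i) := by
  have e1 : ({i, j, l} : Finset α).erase i = {j, l} := by grind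
  have e2 : ({i, j, l} : Finset α).erase j = {i, l} := by grind
  have e3 : ({i, j, l} : Finset α).erase l = {i, j} := by grind
  have h1 : ∀ a b : α, a ≠ b → ({a, b} : Finset α).erase a = {b} := by grind
  have h2 : ∀ a b : α, a ≠ b → ({a, b} : Finset α).erase b = {a} := by grind
  rw [cf_lin_mul, Finset.sum_insert (by simp [hij, hil]), Finset.sum_pair hjl, e1, e2, e3]
  have key : ∀ a b : α, a ≠ b → cf (lin v * (lin w * 1)) {a, b} = v a * w b + v b * w a := by
    intro a b hab
    rw [cf_lin_mul, Finset.sum_pair hab, h1 a b hab, h2 a b hab]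
    simp only [cf_lin_singleton]
  rw [key j l hjl, key i l hil, key i j hij]
  ring

theorem rowStar_three (hr : ∀ i j, r i j = 1 ∨ r i j = -1) {I : Finset ι} {W : Finset α}
    (hI : I.card = 3) (hW : 5 ≤ W.card)
    (hind : Ind r I W) (h : ff W.card 3 2 ≤ nrm W (rowProd r I)) : RowStar r I W := by
  obtain ⟨x, hx, y, hy, hxy, hn⟩ := exists_not_adj hr (by omega) (by omega) hind
  have hyx : y ∈ I.erase x := Finset.mem_erase.2 ⟨hxy.symm, hy⟩
  have hQ : ((I.erase x).erase y).card = 1 := by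
    rw [Finset.card_erase_of_mem hyx, Finset.card_erase_of_mem hx, hI]
  have hcol : (colo r ((I.erase x).erase y) W).card = 0 := by
    have := card_colo_lt hr (Q := (I.erase x).erase y) (W := W)
      (Finset.card_pos.1 (by omega)) (by omega)
    omega
  obtain ⟨-, heq⟩ := nrm_pair_step (K := 0) hr (fun k _ => nrmBound hr k) hI (by omega) hind hx hy
    hxy hn (Or.inl hcol)
  obtain ⟨-, hut, -⟩ := heq h
  obtain ⟨q, hq⟩ := Finset.card_eq_one.1 hQ
  have hprod : rowProd r I = lin (r x) * (lin (r y) * (lin (r q) * 1)) := by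
    rw [rowProd_eq_lin_mul r hx, rowProd_eq_lin_mul r hyx, hq, rowProd, Finset.prod_singleton,
      mul_one]
  obtain ⟨e, he, he2⟩ : ∃ e : ℚ, (e = 1 ∨ e = -1) ∧
      (W.filter fun j => r x j * r y j = e).card = 2 := by
    rcases hut with h | h
    exacts [⟨1, Or.inl rfl, h⟩, ⟨-1, Or.inr rfl, h⟩]
  set C := W.filter fun j => r x j * r y j = e with hC
  have hout : ∀ j ∈ W \ C, r x j * r y j = -e := by
    intro j hj
    simp only [hC, Finset.mem_sdiff, Finset.mem_filter, not_and] at hj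
    have h' := hj.2 hj.1
    rcases he with rfl | rfl <;> rcases prod_eq_or hr x y j with h | h <;> simp_all
  have habs : ∀ q j, |r q j| = 1 := abs_row hr
  have hsum : ∑ S ∈ W.powerset, pairSum (fun j => r x j * r y j) (lin (r q) * 1) S ≤
      nrm W (rowProd r I) := by
    refine le_trans ?_ h
    rw [sum_pairSum]
    refine (Finset.sum_le_sum fun i hi => Finset.sum_le_sum fun j hj => ?_).trans
      (le_of_eq (sum_same_sign (prod_eq_or hr x y) W ((W.card : ℚ) - 2))) |>.trans ?_
    · have hjc : ((W.erase i).erase j).card = W.card - 2 := by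
        rw [Finset.card_erase_of_mem hj, Finset.card_erase_of_mem hi]
        omega
      split_ifs
      · refine (nrm_lin_mul_le _ (habs q) _ _).trans ?_
        simp only [nrm_one, Finset.sum_const, nsmul_eq_mul, mul_one, hjc]
        rw [Nat.cast_sub (by omega)]
        norm_num
      · rfl
    · have hc := card_eq_card_add_card (prod_eq_or hr x y) W
      have htop := ff_top W.card 0 (by omega)
      have hone := ff_one (W.card - 2)
      rw [Nat.cast_sub (by omega)] at hone
      simp only [Nat.zero_add] at htop
      rw [hone] at htop
      rw [htop]
      refine le_of_eq ?_
      rcases hut with h2 | h2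
      · rw [h2] at hc ⊢
        have hc' : (W.card : ℚ) = 2 + (W.filter fun j => r x j * r y j = -1).card := by
          exact_mod_cast hc
        rw [hc']
        push_cast
        ring
      · rw [h2] at hc ⊢
        have hc' : (W.card : ℚ) = (W.filter fun j => r x j * r y j = 1).card + 2 := by
          exact_mod_cast hc
        rw [hc']
        push_cast
        ring
  have hle : ∀ S ∈ W.powerset, |cf (rowProd r I) S| ≤
      pairSum (fun j => r x j * r y j) (lin (r q) * 1) S := by
    intro S _
    rw [hprod]
    exact abs_cf_pair_le _ _ (hr x) (hr y) _ S
  have hpt := (Finset.sum_eq_sum_iff_of_le hle).1 (le_antisymm (Finset.sum_le_sum hle) hsum)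
  have hconst : ∀ i ∈ W \ C, ∀ j ∈ W \ C, ∀ l ∈ W \ C, i ≠ j → i ≠ l → j ≠ l →
      r q i * r x i = r q j * r x j := by
    intro i hi j hj l hl hij hil hjl
    have hsub : ({i, j, l} : Finset α) ∈ W.powerset := by
      refine Finset.mem_powerset.2 fun m hm => ?_
      simp only [Finset.mem_insert, Finset.mem_singleton] at hm
      rcases hm with rfl | rfl | rfl
      exacts [(Finset.mem_sdiff.1 hi).1, (Finset.mem_sdiff.1 hj).1, (Finset.mem_sdiff.1 hl).1]
    have h1 := hpt _ hsub
    have h2 : pairSum (fun j => r x j * r y j) (lin (r q) * 1) {i, j, l} = 6 := by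
      have hS3 : ({i, j, l} : Finset α).card = 3 := Finset.card_eq_three.2
        ⟨i, j, l, hij, hil, hjl, rfl⟩
      have hSe : ∀ m ∈ ({i, j, l} : Finset α), r x m * r y m = -e := by
        intro m hm
        simp only [Finset.mem_insert, Finset.mem_singleton] at hm
        rcases hm with rfl | rfl | rfl
        exacts [hout _ hi, hout _ hj, hout _ hl]
      have hterm : ∀ a ∈ ({i, j, l} : Finset α), ∀ b ∈ ({i, j, l} : Finset α).erase a,
          (if r x a * r y a = r x b * r y b then
            |cf (lin (r q) * 1) ((({i, j, l} : Finset α).erase a).erase b)| else 0) = 1 := by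
        intro a ha b hb
        rw [if_pos (by rw [hSe a ha, hSe b (Finset.mem_of_mem_erase hb)])]
        obtain ⟨c, hc⟩ : ∃ c, (({i, j, l} : Finset α).erase a).erase b = {c} :=
          Finset.card_eq_one.1 (by
            rw [Finset.card_erase_of_mem hb, Finset.card_erase_of_mem ha, hS3])
        rw [hc]
        rw [cf_lin_singleton, habs]
      rw [pairSum, Finset.sum_congr rfl fun a ha => Finset.sum_congr rfl (hterm a ha)]
      rw [Finset.sum_congr rfl fun a ha => by
        rw [Finset.sum_const, Finset.card_erase_of_mem ha, hS3]]
      rw [Finset.sum_const, hS3]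
      norm_num
    rw [h2, hprod, cf_three _ _ _ hij hil hjl] at h1
    have hyx' : ∀ m ∈ W \ C, r y m = -e * r x m := fun m hm => by
      linear_combination r x m * hout m hm - r y m * row_sq hr x m
    rw [hyx' i hi, hyx' j hj, hyx' l hl] at h1
    have h3 : r x i * (-e * r x j * r q l + -e * r x l * r q j) +
        r x j * (-e * r x i * r q l + -e * r x l * r q i) +
        r x l * (-e * r x i * r q j + -e * r x j * r q i) =
        (-e * (r x i * r x j * r x l)) *
          (2 * (r q i * r x i + r q j * r x j + r q l * r x l)) := by
      linear_combination (2 * e) * (r x j * r x l * r q i * row_sq hr x i +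
        r x i * r x l * r q j * row_sq hr x j + r x i * r x j * r q l * row_sq hr x l)
    have he1 : |e| = 1 := by rcases he with rfl | rfl <;> norm_num
    rw [h3, abs_mul, abs_mul, abs_mul, abs_mul, habs, habs, habs, abs_neg, he1] at h1
    revert h1
    rcases prod_eq_or hr q x i with h4 | h4 <;> rcases prod_eq_or hr q x j with h5 | h5 <;>
      rcases prod_eq_or hr q x l with h6 | h6 <;> rw [h4, h5, h6] <;> norm_num
  have hWC : (W \ C).card = W.card - 2 := by
    rw [Finset.card_sdiff_of_subset (Finset.filter_subset _ _), he2]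
  have hqx : PropOn r q x (W \ C) := by
    obtain ⟨b, hb⟩ := Finset.card_pos.1 (by omega : 0 < (W \ C).card)
    refine (propOn_iff hr).2 ⟨r q b * r x b, prod_eq_or hr q x b, fun j hj => ?_⟩
    by_cases hjb : j = b
    · rw [hjb]
    · obtain ⟨l, hl, hlj⟩ : ∃ l ∈ W \ C, l ∉ ({j, b} : Finset α) := by
        by_contra! hcon
        have := Finset.card_le_card (show W \ C ⊆ {j, b} from hcon)
        have := Finset.card_le_two (a := j) (b := b)
        omega
      simp only [Finset.mem_insert, Finset.mem_singleton, not_or] at hlj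
      exact hconst j hj b hb l hl hjb (Ne.symm hlj.1) (Ne.symm hlj.2)
  have hxy' : PropOn r x y (W \ C) :=
    (propOn_iff hr).2 ⟨-e, by rcases he with rfl | rfl <;> norm_num, hout⟩
  have hx' : ∀ p ∈ I, PropOn r p x (W \ C) := by
    intro p hp
    by_cases hpx : p = x
    · exact ⟨1, fun j _ => by rw [hpx, one_mul]⟩
    · by_cases hpy : p = y
      · rw [hpy]
        exact hxy'.symm hr
      · have : p ∈ (I.erase x).erase y := by simp [hpx, hpy, hp]
        rw [hq, Finset.mem_singleton] at this
        rwa [this]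
  exact star_of_card_three hr hI (Finset.filter_subset _ _) he2
    (fun p hp q hq => (hx' p hp).trans ((hx' q hq).symm hr))
    fun p hp q hq hpq => hind.not_propOn hp hq hpq

theorem erase_erase_four {I : Finset ι} {x y p q : ι} (hI : I = {x, y, p, q}) (hxp : p ≠ x)
    (hpq : p ≠ q) (hyp : p ≠ y) (hxy : x ≠ y) (hqx : q ≠ x) (hqy : q ≠ y) :
    (I.erase x).erase p = {y, q} ∧ (I.erase y).erase p = {x, q} := by
  constructor <;> ext z <;> simp only [hI, Finset.mem_erase, Finset.mem_insert,
    Finset.mem_singleton] <;> grind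

theorem rowStar_four (hr : ∀ i j, r i j = 1 ∨ r i j = -1) {I : Finset ι} {W : Finset α}
    (hI : I.card = 4) (hW : 5 ≤ W.card)
    (hind : Ind r I W) (h : ff W.card 4 3 ≤ nrm W (rowProd r I)) : RowStar r I W := by
  obtain ⟨x, hx, y, hy, hxy, hn⟩ := exists_not_adj hr (by omega) (by omega) hind
  have hcompl : ∀ x ∈ I, ∀ y ∈ I, ∀ p q, x ≠ y → p ≠ q → (I.erase x).erase y = {p, q} →
      ¬ Adj r W x y → Adj r W p q := by
    intro x hx y hy p q hxy hpq hQ hn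
    by_contra hpqn
    exact absurd h (not_le.2 (nrm_four_rows_lt hr hx hy hxy hQ hpq hW hn hpqn))
  have hyx : y ∈ I.erase x := Finset.mem_erase.2 ⟨hxy.symm, hy⟩
  obtain ⟨p, q, hpq, hQ⟩ := Finset.card_eq_two.1
    (show ((I.erase x).erase y).card = 2 by
      rw [Finset.card_erase_of_mem hyx, Finset.card_erase_of_mem hx, hI])
  have hp : p ∈ (I.erase x).erase y := by simp [hQ]
  have hq : q ∈ (I.erase x).erase y := by simp [hQ]
  simp only [Finset.mem_erase] at hp hq
  obtain ⟨hpy, hpx, hp⟩ := hp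
  obtain ⟨hqy, hqx, hq⟩ := hq
  have hI4 : ∀ z ∈ I, z = x ∨ z = y ∨ z = p ∨ z = q := by
    intro z hz
    by_cases h1 : z = x
    · exact Or.inl h1
    by_cases h2 : z = y
    · exact Or.inr (Or.inl h2)
    have : z ∈ (I.erase x).erase y := by simp [h1, h2, hz]
    rw [hQ, Finset.mem_insert, Finset.mem_singleton] at this
    exact Or.inr (Or.inr this)
  have hI4' : I = {x, y, p, q} := by
    ext z
    simp only [Finset.mem_insert, Finset.mem_singleton]
    exact ⟨hI4 z, by rintro (rfl | rfl | rfl | rfl) <;> assumption⟩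
  have hapq := hcompl x hx y hy p q hxy hpq hQ hn
  have htri : ∀ a ∈ I, ∀ b ∈ I, ∀ c ∈ I, a ≠ b → b ≠ c → a ≠ c → Adj r W a b → Adj r W b c →
      ¬ Adj r W a c := fun a ha b hb c hc hab hbc hac h1 h2 h3 =>
    Adj.triangle_free hr (by omega) (hind.not_propOn ha hb hab) (hind.not_propOn hb hc hbc)
      (hind.not_propOn ha hc hac) h1 h2 h3
  have key : ∀ p q, p ∈ I → q ∈ I → I = {x, y, p, q} → p ≠ q → p ≠ x → p ≠ y → q ≠ x → q ≠ y →
      Adj r W p q → ¬ Adj r W x p → RowStar r I W := by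
    intro p q hp hq hI hpq hpx hpy hqx hqy ha hxp
    have h1 : Adj r W y q := hcompl x hx p hp y q hpx.symm hqy.symm
      (erase_erase_four hI hpx hpq hpy hxy hqx hqy).1 hxp
    have h2 : ¬ Adj r W y p := htri y hy q hq p hp hqy.symm hpq.symm hpy.symm h1 (ha.symm hr)
    have h3 : Adj r W x q := hcompl y hy p hp x q hpy.symm hqx.symm
      (erase_erase_four hI hpx hpq hpy hxy hqx hqy).2 h2
    refine ⟨q, hq, fun z hz hzq => ?_⟩
    rw [hI] at hz
    simp only [Finset.mem_insert, Finset.mem_singleton] at hz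
    rcases hz with rfl | rfl | rfl | rfl
    exacts [h3.symm hr, h1.symm hr, ha.symm hr, absurd rfl hzq]
  by_cases hxp : Adj r W x p
  · exact key q p hq hp (by rw [hI4', Finset.pair_comm]) hpq.symm hqx hqy hpx hpy (hapq.symm hr)
      (htri x hx p hp q hq hpx.symm hpq hqx.symm hxp hapq)
  · exact key p q hp hq hI4' hpq hpx hpy hqx hqy hapq hxp

end SmallCases

section EqualityCase

variable {ι α : Type*} [DecidableEq ι] [Fintype α] [DecidableEq α] {r : ι → α → ℚ}

theorem rowStar_sdiff (hr : ∀ i j, r i j = 1 ∨ r i j = -1) {K : ℕ} (hK : 2 ≤ K)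
    (ih : ∀ (I : Finset ι) (W : Finset α), I.card = K + 1 → 4 ≤ I.card → K + 1 < W.card →
      Ind r I W → ff W.card (K + 1) K ≤ nrm W (rowProd r I) → RowStar r I W)
    {I : Finset ι} {W : Finset α} (hI : I.card = K + 3) (hW : K + 3 < W.card) (hind : Ind r I W)
    (h : ff W.card (K + 3) (K + 2) ≤ nrm W (rowProd r I)) {x y : ι} (hx : x ∈ I) (hy : y ∈ I)
    (hxy : x ≠ y) (hn : ¬ Adj r W x y) : RowStar r ((I.erase x).erase y) W := by
  obtain ⟨-, heq⟩ := nrm_pair_step hr (fun k _ => nrmBound hr k) hI hW hind hx hy hxy hn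
    (Or.inr hK)
  obtain ⟨hC, -, hnrm⟩ := heq h
  set Q := (I.erase x).erase y with hQdef
  have hyx : y ∈ I.erase x := Finset.mem_erase.2 ⟨hxy.symm, hy⟩
  have hQI : Q ⊆ I := (Finset.erase_subset _ _).trans (Finset.erase_subset _ _)
  have hQ : Q.card = K + 1 := by
    rw [hQdef, Finset.card_erase_of_mem hyx, Finset.card_erase_of_mem hx, hI]
    omega
  have hprop : ∀ p ∈ Q, ∀ q ∈ Q, PropOn r p q (W \ colo r Q W) := fun p hp q hq =>
    propOn_of_card_colo hr (by omega) (by omega) hp hq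
  have hindQ := hind.mono hQI
  rcases hK.eq_or_lt with rfl | hK
  · exact star_of_card_three hr hQ colo_subset hC hprop
      fun p hp q hq hpq => hindQ.not_propOn hp hq hpq
  obtain ⟨i, hi, j, hj, hij, hs⟩ : ∃ i ∈ W \ colo r Q W, ∃ j ∈ W \ colo r Q W, i ≠ j ∧
      r x i * r y i = r x j * r y j := by
    refine Finset.exists_ne_map_eq_of_card_lt_of_maps_to (t := {1, -1}) ?_ fun i _ => ?_
    · rw [Finset.card_sdiff_of_subset colo_subset]
      have := Finset.card_le_two (a := (1 : ℚ)) (b := -1)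
      omega
    · simpa using prod_eq_or hr x y i
  obtain ⟨hiW, hiC⟩ := Finset.mem_sdiff.1 hi
  obtain ⟨hjW, hjC⟩ := Finset.mem_sdiff.1 hj
  have hindj := hindQ.erase hjC
  have hcj := Finset.card_erase_of_mem hjW
  have hci : ((W.erase j).erase i).card = W.card - 2 := by
    rw [Finset.card_erase_of_mem (Finset.mem_erase.2 ⟨hij, hiW⟩), hcj]
    omega
  have hCe : colo r Q W = colo r Q (W.erase j) := by
    refine Finset.eq_of_subset_of_card_le
      (fun m hm => colo_erase hm (by rintro rfl; exact hjC hm)) ?_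
    have := card_colo_lt hr (Q := Q) (W := W.erase j) (Finset.card_pos.1 (by omega)) (by omega)
    omega
  have hindij := hindj.erase (hCe ▸ hiC)
  refine RowStar.of_erase hr colo_subset (by omega) hiC hjC hprop ?_
  refine ih Q _ hQ (by omega) (by omega) hindij ?_
  rw [hci, hnrm j hjW hjC i hiW hiC hij hs]

/-- Families of rows attaining the bound `ff` are stars. -/
theorem rowStar_of_le (hr : ∀ i j, r i j = 1 ∨ r i j = -1) (k : ℕ) :
    ∀ (I : Finset ι) (W : Finset α), I.card = k → 2 ≤ k → k < W.card →
    ¬ (k = 3 ∧ W.card = 4) → Ind r I W →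
    ff W.card k (k - 1) ≤ nrm W (rowProd r I) → RowStar r I W := by
  induction k using Nat.strong_induction_on with
  | _ k ih =>
    intro I W hI hk hkW hne hind h
    match k, hk with
    | 2, _ =>
      obtain ⟨p, q, hpq, rfl⟩ := Finset.card_eq_two.1 hI
      have hp := hind.not_propOn (x := p) (y := q) (by simp) (by simp) hpq
      rw [ff_two _ (by omega)] at h
      have ha := (nrm_two_rows_le hr hpq hp).2 h
      refine ⟨p, by simp, fun z hz hzp => ?_⟩
      simp only [Finset.mem_insert, Finset.mem_singleton, hzp, false_or] at hz
      rwa [hz]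
    | 3, _ => exact rowStar_three hr hI (by omega) hind h
    | 4, _ => exact rowStar_four hr hI (by omega) hind h
    | K + 5, _ =>
      obtain ⟨x, hx, y, hy, hxy, hn⟩ := exists_not_adj hr (by omega) (by omega) hind
      have hsd : ∀ x ∈ I, ∀ y ∈ I, x ≠ y → ¬ Adj r W x y → RowStar r ((I.erase x).erase y) W :=
        fun x hx y hy hxy hn => rowStar_sdiff hr (K := K + 2) (by omega)
          (fun J V hJ hJ4 hV hJV hle => ih (K + 3) (by omega) J V hJ (by omega) hV (by omega) hJV
            hle) hI hkW hind h hx hy hxy hn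
      refine exists_star_center (R := Adj r W) (by omega) (fun _ _ h => h.symm hr) ?_ hsd ?_ hx hy
        hxy hn
      · intro x hx y hy z hz hxy hyz hxz h1 h2 h3
        exact Adj.triangle_free hr (by omega) (hind.not_propOn hx hy hxy)
          (hind.not_propOn hy hz hyz) (hind.not_propOn hx hz hxz) h1 h2 h3
      · intro x hx y hy hxy hn p hp q hq w hw hpq hpw hqw hpx hpy hqx hqy hwx hwy
        have hT : ∀ m ∈ ({p, q, w} : Finset ι), m ∈ I ∧ Adj r W m x ∧ Adj r W m y := by
          intro m hm
          simp only [Finset.mem_insert, Finset.mem_singleton] at hm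
          rcases hm with rfl | rfl | rfl
          exacts [⟨hp, hpx, hpy⟩, ⟨hq, hqx, hqy⟩, ⟨hw, hwx, hwy⟩]
        have hT' : ∀ m ∈ ({p, q, w} : Finset ι), m ≠ x ∧ m ≠ y := fun m hm =>
          ⟨by rintro rfl; exact hn (hT _ hm).2.2, by rintro rfl; exact hn ((hT _ hm).2.1.symm hr)⟩
        exact not_propOn_triple hr (by omega) (T := {p, q, w})
          (Finset.card_eq_three.2 ⟨p, q, w, hpq, hpw, hqw, rfl⟩) (hind.not_propOn hx hy hxy)
          (fun a ha b hb hab => hind.not_propOn (hT a ha).1 (hT b hb).1 hab)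
          (fun m hm => ⟨hind.not_propOn (hT m hm).1 hx (hT' m hm).1, (hT m hm).2.1⟩)
          fun m hm => ⟨hind.not_propOn (hT m hm).1 hy (hT' m hm).2, (hT m hm).2.2⟩

end EqualityCase

section NormalForm

variable {k n : ℕ}

/-- A sign matrix whose rows are, up to sign, a fixed row `p`, or `p` with one entry negated (at
pairwise different places), is equivalent to some `Dr n k l`. -/
theorem rectEquiv_of_flip (hkn : k < n) {A : Matrix (Fin k) (Fin n) ℚ} {p : Fin n → ℚ}
    (hp : ∀ j, p j = 1 ∨ p j = -1) {T : Finset (Fin k)} {l : ℕ} (hl : T.card = l)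
    (hT : ∀ i ∈ T, ∃ a, ∃ e : ℚ, (e = 1 ∨ e = -1) ∧
      ∀ j, A i j = e * p j * if j = a then -1 else 1)
    (hT' : ∀ i ∉ T, ∃ e : ℚ, (e = 1 ∨ e = -1) ∧ ∀ j, A i j = e * p j)
    (hne : ∀ i ∈ T, ∀ i' ∈ T, i ≠ i' → ¬ PropOn A i i' Finset.univ) :
    RectEquiv A (Dr n k l) := by
  have : Nonempty (Fin n) := ⟨⟨0, by omega⟩⟩
  have hall : ∀ i, ∃ a, ∃ e : ℚ, (e = 1 ∨ e = -1) ∧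
      ∀ j, A i j = e * p j * if i ∈ T ∧ j = a then -1 else 1 := by
    intro i
    by_cases hi : i ∈ T
    · simpa [hi] using hT i hi
    · obtain ⟨e, he, h⟩ := hT' i hi
      exact ⟨Classical.arbitrary _, e, he, by simpa [hi] using h⟩
  choose a e he hA using hall
  have hinj : Set.InjOn a T := by
    intro i hi i' hi' h
    by_contra hii
    refine hne i hi i' hi' hii ⟨e i * e i', fun j _ => ?_⟩
    have hee : e i' * e i' = 1 := by rcases he i' with h | h <;> rw [h] <;> norm_num
    rw [hA i j, hA i' j, h]
    simp only [Finset.mem_coe.1 hi, Finset.mem_coe.1 hi', true_and]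
    linear_combination (-(e i * p j * if j = a i' then -1 else 1)) * hee
  have hlk : l ≤ k := by
    have := Finset.card_le_univ T
    rwa [Fintype.card_fin, hl] at this
  obtain ⟨ρ, hρ⟩ := Equiv.Perm.exists_extending_pair (T.orderEmbOfFin hl)
    (Fin.castLE hlk) (T.orderEmbOfFin hl).injective (Fin.castLE_injective hlk)
  have hfT : ∀ t, T.orderEmbOfFin hl t ∈ T := Finset.orderEmbOfFin_mem T hl
  obtain ⟨σ, hσ⟩ := Equiv.Perm.exists_extending_pair (fun t => a (T.orderEmbOfFin hl t))
    (Fin.castLE (hlk.trans hkn.le))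
    (fun s t h => (T.orderEmbOfFin hl).injective (hinj (hfT s) (hfT t) h))
    (Fin.castLE_injective _)
  have hρT : ∀ i, i ∈ T ↔ (ρ i : ℕ) < l := by
    intro i
    constructor
    · intro hi
      obtain ⟨t, rfl⟩ : i ∈ Set.range (T.orderEmbOfFin hl) := by
        rw [Finset.range_orderEmbOfFin]
        exact hi
      rw [hρ t]
      exact t.2
    · intro hi
      have h1 : ρ (T.orderEmbOfFin hl ⟨ρ i, hi⟩) = ρ i := hρ ⟨ρ i, hi⟩
      rw [← ρ.injective h1]
      exact hfT _
  have hσa : ∀ i ∈ T, (σ (a i) : ℕ) = ρ i := by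
    intro i hi
    obtain ⟨t, rfl⟩ : i ∈ Set.range (T.orderEmbOfFin hl) := by
      rw [Finset.range_orderEmbOfFin]
      exact hi
    rw [hρ t, hσ t]
    rfl
  refine ⟨ρ, σ, e, p, he, hp, fun i j => ?_⟩
  rw [hA i j, Dr]
  congr 1
  refine if_congr ?_ rfl rfl
  constructor
  · rintro ⟨hi, rfl⟩
    rw [hσa i hi]
    exact ⟨rfl, (hρT i).1 hi⟩
  · rintro ⟨h1, h2⟩
    have hi := (hρT i).2 (h1 ▸ h2)
    refine ⟨hi, σ.injective (Fin.ext ?_)⟩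
    rw [hσa i hi, h1]

theorem RowStar.rectEquiv (hkn : k < n) {A : Matrix (Fin k) (Fin n) ℚ}
    (hA : ∀ i j, A i j = 1 ∨ A i j = -1) (hind : Ind A Finset.univ Finset.univ)
    (h : RowStar A Finset.univ Finset.univ) : RectEquiv A (Dr n k (k - 1)) := by
  obtain ⟨z, -, h⟩ := h
  have hnp : ∀ {i i'}, i ≠ i' → ¬ PropOn A i i' Finset.univ := fun hii =>
    hind.not_propOn (Finset.mem_univ _) (Finset.mem_univ _) hii
  refine rectEquiv_of_flip hkn (p := A z) (hA z) (T := Finset.univ.erase z)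
    (by rw [Finset.card_erase_of_mem (Finset.mem_univ _), Finset.card_univ, Fintype.card_fin])
    (fun i hi => ?_) (fun i hi => ⟨1, Or.inl rfl, fun j => ?_⟩) fun i _ i' _ hii => hnp hii
  · have hiz := Finset.ne_of_mem_erase hi
    obtain ⟨a, -, e, he, h1, h2⟩ := (h i (Finset.mem_univ _) hiz).exists_sign hA (hnp hiz.symm)
    refine ⟨a, e, he, fun j => ?_⟩
    split_ifs with hj
    · rw [hj]
      linear_combination A z a * h2 - A i a * row_sq hA z a
    · linear_combination A z j * h1 j (Finset.mem_univ _) hj - A i j * row_sq hA z j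
  · rw [one_mul]
    congr 1
    simpa using hi

theorem exists_flip_of_odd {u v : Fin 4 → ℚ} (hu : ∀ j, u j = 1 ∨ u j = -1)
    (hv : ∀ j, v j = 1 ∨ v j = -1) (h : ∏ j, u j * v j = -1) :
    ∃ a, ∃ e : ℚ, (e = 1 ∨ e = -1) ∧ ∀ j, v j = e * u j * if j = a then -1 else 1 := by
  have huu : ∀ j, u j * u j = 1 := fun j => by rcases hu j with h | h <;> rw [h] <;> norm_num
  suffices H : ∃ a : Fin 4, ∃ e : ℚ, (e = 1 ∨ e = -1) ∧
      ∀ j, u j * v j = e * if j = a then -1 else 1 by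
    obtain ⟨a, e, he, H⟩ := H
    exact ⟨a, e, he, fun j => by linear_combination u j * H j - v j * huu j⟩
  have hs : ∀ j, u j * v j = 1 ∨ u j * v j = -1 := fun j => by
    rcases hu j with h | h <;> rcases hv j with h' | h' <;> rw [h, h'] <;> norm_num
  rw [Fin.prod_univ_four] at h
  rcases hs 0 with h0 | h0 <;> rcases hs 1 with h1 | h1 <;> rcases hs 2 with h2 | h2 <;>
    rcases hs 3 with h3 | h3 <;> rw [h0, h1, h2, h3] at h <;> norm_num at h
  exacts [⟨3, 1, by simp [Fin.forall_fin_succ, *]⟩, ⟨2, 1, by simp [Fin.forall_fin_succ, *]⟩,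
    ⟨1, 1, by simp [Fin.forall_fin_succ, *]⟩, ⟨0, -1, by simp [Fin.forall_fin_succ, *]⟩,
    ⟨0, 1, by simp [Fin.forall_fin_succ, *]⟩, ⟨1, -1, by simp [Fin.forall_fin_succ, *]⟩,
    ⟨2, -1, by simp [Fin.forall_fin_succ, *]⟩, ⟨3, -1, by simp [Fin.forall_fin_succ, *]⟩]

end NormalForm

section LowerBound

variable {ι α : Type*} [DecidableEq ι] [Fintype α] [DecidableEq α]

/-- The sum of the squarefree coefficients of `Q` supported in `W`. -/
noncomputable def cfSum (W : Finset α) (Q : MvPolynomial α ℚ) : ℚ :=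
  ∑ S ∈ W.powerset, cf Q S

theorem cfSum_le_nrm (W : Finset α) (Q : MvPolynomial α ℚ) : cfSum W Q ≤ nrm W Q :=
  Finset.sum_le_sum fun _ _ => le_abs_self _

theorem cfSum_lin_mul (v : α → ℚ) (W : Finset α) (Q : MvPolynomial α ℚ) :
    cfSum W (lin v * Q) = ∑ j ∈ W, v j * cfSum (W.erase j) Q := by
  unfold cfSum
  simp_rw [cf_lin_mul, Finset.mul_sum]
  exact sum_powerset_erase W fun j T => v j * cf Q T

theorem cfSum_rowProd_one (I : Finset ι) :
    ∀ W : Finset α, cfSum W (rowProd (fun _ _ => 1) I) = W.card.descFactorial I.card := by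
  induction I using Finset.induction_on with
  | empty =>
    intro W
    simp [rowProd, cfSum, cf_one]
  | insert i I hi ih =>
    intro W
    rw [rowProd_eq_lin_mul _ (Finset.mem_insert_self i I), Finset.erase_insert hi, cfSum_lin_mul,
      Finset.sum_congr rfl fun j hj => by rw [ih, Finset.card_erase_of_mem hj],
      Finset.sum_const, nsmul_eq_mul, one_mul, Finset.card_insert_of_notMem hi]
    cases W.card with
    | zero => simp
    | succ m =>
      rw [Nat.succ_descFactorial_succ, Nat.add_sub_cancel]
      push_cast
      ring

theorem cfSum_rowProd_flip (b : ι → α) (T : Finset ι) :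
    ∀ (I : Finset ι) (W : Finset α), T ⊆ I → Set.InjOn b T → (∀ i ∈ T, b i ∈ W) →
      cfSum W (rowProd (fun i j => if i ∈ T ∧ j = b i then -1 else 1) I) =
        ff W.card I.card T.card := by
  induction T using Finset.induction_on with
  | empty =>
    intro I W _ _ _
    simpa [ff] using cfSum_rowProd_one I W
  | insert t T ht ih =>
    intro I W hTI hb hW
    have htI := hTI (Finset.mem_insert_self t T)
    have hT : T ⊆ I.erase t := fun i hi =>
      Finset.mem_erase.2 ⟨fun h => ht (h ▸ hi), hTI (Finset.mem_insert_of_mem hi)⟩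
    have hb' : Set.InjOn b T := hb.mono (by simp)
    have hbt : ∀ i ∈ T, b i ∈ W.erase (b t) := fun i hi =>
      Finset.mem_erase.2 ⟨fun h => ht (hb (by simp) (by simp [hi]) h.symm ▸ hi),
        hW i (Finset.mem_insert_of_mem hi)⟩
    have h1 := ih I W (hT.trans (Finset.erase_subset _ _)) hb'
      fun i hi => hW i (Finset.mem_insert_of_mem hi)
    have h2 := ih (I.erase t) (W.erase (b t)) hT hb' hbt
    rw [rowProd_eq_lin_mul _ htI, cfSum_lin_mul] at h1 ⊢
    rw [show rowProd (fun i j => if i ∈ insert t T ∧ j = b i then (-1 : ℚ) else 1) (I.erase t) =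
        rowProd (fun i j => if i ∈ T ∧ j = b i then (-1 : ℚ) else 1) (I.erase t) from
      Finset.prod_congr rfl fun i hi => by simp [Finset.ne_of_mem_erase hi]]
    have hbW := hW t (Finset.mem_insert_self t T)
    rw [Finset.card_insert_of_notMem ht, ff_succ, ← h1, ← Finset.card_erase_of_mem hbW,
      ← Finset.card_erase_of_mem htI, ← h2, ← Finset.add_sum_erase _ _ hbW,
      ← Finset.add_sum_erase _ _ hbW, Finset.sum_congr rfl fun j hj => by
        rw [if_neg fun h => Finset.ne_of_mem_erase hj h.2]]
    simp only [ht, false_and, if_false, Finset.mem_insert_self, true_and, if_true]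
    ring

theorem ff_le_nrm_Dr {n k l : ℕ} (hlk : l ≤ k) (hkn : k ≤ n) :
    ff n k l ≤ nrm Finset.univ (rowProd (Dr n k l) Finset.univ) := by
  have h := cfSum_rowProd_flip (Fin.castLE hkn) (Finset.univ.map (Fin.castLEEmb hlk))
    Finset.univ Finset.univ (Finset.subset_univ _) (Fin.castLE_injective hkn).injOn
    fun _ _ => Finset.mem_univ _
  rw [Finset.card_map, Finset.card_univ, Finset.card_univ, Finset.card_univ, Fintype.card_fin,
    Fintype.card_fin, Fintype.card_fin] at h
  rw [← h]
  refine (cfSum_le_nrm _ _).trans (le_of_eq ?_)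
  congr 2
  ext i j
  refine if_congr ?_ rfl rfl
  simp only [Finset.mem_map, Finset.mem_univ, true_and, Fin.ext_iff, Fin.castLEEmb_apply,
    Fin.val_castLE]
  constructor
  · rintro ⟨⟨a, ha⟩, h⟩
    exact ⟨h.symm, by omega⟩
  · rintro ⟨h1, h2⟩
    exact ⟨⟨⟨i, by omega⟩, rfl⟩, h1.symm⟩

end LowerBound

section Permanent

variable {α : Type*} [Fintype α] [DecidableEq α] {k n : ℕ}

theorem cf_rowProd_univ (A : Matrix (Fin k) α ℚ) (S : Finset α) :
    cf (rowProd A Finset.univ) S =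
      ∑ g : Fin k → α, if ∑ i, Finsupp.single (g i) 1 = Finsupp.indicator S fun _ _ => 1 then
        ∏ i, A i (g i) else 0 := by
  unfold cf rowProd lin
  rw [Finset.prod_univ_sum, MvPolynomial.coeff_sum, Fintype.piFinset_univ]
  refine Finset.sum_congr rfl fun g _ => ?_
  rw [← MvPolynomial.coeff_monomial, MvPolynomial.monomial_sum_prod]
  simp_rw [MvPolynomial.C_mul_X_eq_monomial]

/-- The coefficients of the product of the row forms are the permanents of the maximal square
submatrices. -/
theorem per_submatrix_eq_cf (A : Matrix (Fin k) α ℚ) (f : Fin k ↪ α) :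
    per (A.submatrix id f) = cf (rowProd A Finset.univ) (Finset.univ.map f) := by
  rw [cf_rowProd_univ, per, ← Finset.sum_filter]
  refine Finset.sum_bij (fun σ _ => fun i => f (σ i)) ?_ ?_ ?_ ?_
  · intro σ _
    refine Finset.mem_filter.2 ⟨Finset.mem_univ _, ?_⟩
    rw [Equiv.sum_comp σ fun i => Finsupp.single (f i) 1]
    ext a
    rw [Finsupp.finsetSum_apply]
    simp only [Finsupp.single_apply, Finsupp.indicator_apply, Finset.mem_map, Finset.mem_univ,
      true_and]
    by_cases h : ∃ i, f i = a
    · obtain ⟨i, rfl⟩ := h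
      simp
    · simp only [h, dite_false]
      exact Finset.sum_eq_zero fun i _ => if_neg fun hi => h ⟨i, hi⟩
  · intro σ _ τ _ h
    ext i
    exact congrArg _ (f.injective (congrFun h i))
  · intro g hg
    have hg := (Finset.mem_filter.1 hg).2
    have hcount : ∀ a, (Finset.univ.filter fun i => g i = a).card =
        if a ∈ Finset.univ.map f then 1 else 0 := by
      intro a
      have := DFunLike.congr_fun hg a
      rw [Finsupp.finsetSum_apply] at this
      simp only [Finsupp.single_apply, Finsupp.indicator_apply, Finset.sum_boole] at this
      simpa using this
    have hmem : ∀ i, ∃ j, f j = g i := by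
      intro i
      by_contra h
      have := hcount (g i)
      rw [if_neg (by simpa using h), Finset.card_eq_zero] at this
      exact Finset.notMem_empty i (this ▸ by simp)
    choose τ hτ using hmem
    have hinj : Function.Injective τ := by
      intro i i' h
      have := hcount (g i)
      rw [if_pos (by rw [← hτ]; simp)] at this
      refine Finset.card_le_one.1 this.le i (by simp) i' ?_
      simp [← hτ, h]
    exact ⟨Equiv.ofBijective τ (Finite.injective_iff_bijective.1 hinj), Finset.mem_univ _,
      funext hτ⟩
  · intro σ _
    rfl

theorem nrm_rowProd_univ (A : Matrix (Fin k) α ℚ) :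
    nrm Finset.univ (rowProd A Finset.univ) =
      ∑ S ∈ Finset.univ.powersetCard k, |cf (rowProd A Finset.univ) S| := by
  refine (Finset.sum_subset (fun S _ => Finset.mem_powerset.2 (Finset.subset_univ _))
    fun S _ hS => ?_).symm
  refine abs_eq_zero.2 (cf_rowProd_eq_zero A Finset.univ S fun h => hS ?_)
  exact Finset.mem_powersetCard_univ.2 (by simpa using h)

theorem mper_eq_nrm (A : Matrix (Fin k) (Fin n) ℚ) :
    mper A = nrm Finset.univ (rowProd A Finset.univ) := by
  rw [nrm_rowProd_univ, ← Finset.sum_attach, mper]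
  refine Finset.sum_congr rfl fun S _ => ?_
  have h := per_submatrix_eq_cf A (S.1.orderEmbOfFin (Finset.mem_powersetCard.1 S.2).2).toEmbedding
  rw [Finset.map_orderEmbOfFin_univ] at h
  rw [← h]
  rfl

theorem abs_per_of_rectEquiv {A B : Matrix (Fin k) (Fin n) ℚ} {ρ : Equiv.Perm (Fin k)}
    {σ : Equiv.Perm (Fin n)} {ε : Fin k → ℚ} {δ : Fin n → ℚ}
    (hε : ∀ i, ε i = 1 ∨ ε i = -1) (hδ : ∀ j, δ j = 1 ∨ δ j = -1)
    (h : ∀ i j, A i j = ε i * δ j * B (ρ i) (σ j)) (f : Fin k ↪ Fin n) :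
    |per (A.submatrix id f)| = |per (B.submatrix id (f.trans σ.toEmbedding))| := by
  have habs : ∀ x : ℚ, x = 1 ∨ x = -1 → |x| = 1 := by
    rintro x (rfl | rfl) <;> simp
  have key : per (A.submatrix id f) =
      (∏ i, ε i) * (∏ i, δ (f i)) * per (B.submatrix id (f.trans σ.toEmbedding)) := by
    unfold per
    rw [Finset.mul_sum, ← Equiv.sum_comp (Equiv.mulRight ρ)]
    refine Finset.sum_congr rfl fun τ _ => ?_
    simp only [Equiv.coe_mulRight, Equiv.Perm.mul_apply, submatrix_apply, id_eq, h,
      Finset.prod_mul_distrib, Function.Embedding.trans_apply, Equiv.coe_toEmbedding]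
    rw [Equiv.prod_comp ρ fun i => δ (f (τ i)), Equiv.prod_comp τ fun i => δ (f i),
      Equiv.prod_comp ρ fun i => B i (σ (f (τ i)))]
  rw [key, abs_mul, abs_mul, Finset.abs_prod, Finset.abs_prod,
    Finset.prod_eq_one fun i _ => habs _ (hε i), Finset.prod_eq_one fun i _ => habs _ (hδ (f i)),
    one_mul, one_mul]

theorem RectEquiv.mper_eq {A B : Matrix (Fin k) (Fin n) ℚ} (h : RectEquiv A B) :
    mper A = mper B := by
  obtain ⟨ρ, σ, ε, δ, hε, hδ, h⟩ := h
  rw [mper_eq_nrm, mper_eq_nrm, nrm_rowProd_univ, nrm_rowProd_univ]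
  refine Finset.sum_bij (fun S _ => S.map σ.toEmbedding) ?_ ?_ ?_ ?_
  · intro S hS
    simpa [Finset.mem_powersetCard_univ] using hS
  · intro S _ T _ hST
    exact Finset.map_injective _ hST
  · intro T hT
    exact ⟨T.map σ.symm.toEmbedding, by simpa [Finset.mem_powersetCard_univ] using hT,
      by ext; simp⟩
  · intro S hS
    have hf := Finset.map_orderEmbOfFin_univ S (Finset.mem_powersetCard_univ.1 hS)
    have := abs_per_of_rectEquiv hε hδ h
      (S.orderEmbOfFin (Finset.mem_powersetCard_univ.1 hS)).toEmbedding
    rwa [per_submatrix_eq_cf, per_submatrix_eq_cf, ← Finset.map_map, hf] at this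

theorem ind_of_rank_eq {A : Matrix (Fin k) (Fin n) ℚ} (h : A.rank = k) :
    Ind A Finset.univ Finset.univ := by
  have hli : LinearIndependent ℚ A.row := by
    rw [linearIndependent_iff_card_eq_finrank_span, Fintype.card_fin, Set.finrank,
      ← Matrix.rank_eq_finrank_span_row, h]
  intro z hz i _
  refine Fintype.linearIndependent_iff.1 hli z (funext fun j => ?_) i
  simpa [Finset.sum_apply] using hz j (Finset.mem_univ _)

end Permanent

section ThreeFour

theorem mper_three_four (A : Matrix (Fin 3) (Fin 4) ℚ) :
    mper A = ∑ a : Fin 4, |per (A.submatrix id a.succAbove)| := by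
  rw [mper_eq_nrm, nrm_rowProd_univ,
    show (Finset.univ : Finset (Fin 4)).powersetCard 3 =
      Finset.univ.image fun a : Fin 4 => Finset.univ.map a.succAboveEmb by decide,
    Finset.sum_image (by decide)]
  exact Finset.sum_congr rfl fun a _ => by rw [← per_submatrix_eq_cf]; rfl

theorem mper_Dr_three : mper (Dr 4 3 3) = mper (Dr 4 3 2) := by
  rw [mper_three_four, mper_three_four]
  decide +kernel

/-- Every `3 × 4` sign matrix of rank `3` is equivalent to `Dr 4 3 2` or `Dr 4 3 3`. -/
theorem rectEquiv_three_four {A : Matrix (Fin 3) (Fin 4) ℚ}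
    (hA : ∀ i j, A i j = 1 ∨ A i j = -1) (hind : Ind A Finset.univ Finset.univ) :
    RectEquiv A (Dr 4 3 2) ∨ RectEquiv A (Dr 4 3 3) := by
  have hnp : ∀ {i i'}, i ≠ i' → ¬ PropOn A i i' Finset.univ := fun hii =>
    hind.not_propOn (Finset.mem_univ _) (Finset.mem_univ _) hii
  have hs : ∀ i i', ∏ j, A i j * A i' j = 1 ∨ ∏ j, A i j * A i' j = -1 := by
    intro i i'
    exact Finset.prod_induction _ (fun x : ℚ => x = 1 ∨ x = -1)
      (by rintro _ _ (rfl | rfl) (rfl | rfl) <;> simp) (Or.inl rfl) fun j _ => by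
        rcases hA i j with h | h <;> rcases hA i' j with h' | h' <;> simp [h, h']
  have hcenter : ∀ z, (∀ i, i ≠ z → ∏ j, A z j * A i j = -1) → RectEquiv A (Dr 4 3 2) := by
    intro z hz
    refine rectEquiv_of_flip (by norm_num) (hA z) (T := Finset.univ.erase z) (by simp)
      (fun i hi => exists_flip_of_odd (hA z) (hA i) (hz i (Finset.ne_of_mem_erase hi)))
      (fun i hi => ⟨1, Or.inl rfl, fun j => ?_⟩) fun i _ i' _ hii => hnp hii
    obtain rfl : i = z := by simpa using hi
    rw [one_mul]
  have hcomm : ∀ i i', ∏ j, A i j * A i' j = ∏ j, A i' j * A i j := fun i i' =>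
    Finset.prod_congr rfl fun j _ => mul_comm _ _
  have hself : ∀ i, ∏ j, A i j * A i j = 1 := fun i =>
    Finset.prod_eq_one fun j _ => row_sq hA i j
  have hmul : (∏ j, A 0 j * A 1 j) * (∏ j, A 0 j * A 2 j) = ∏ j, A 1 j * A 2 j := by
    rw [← Finset.prod_mul_distrib]
    exact Finset.prod_congr rfl fun j _ => by linear_combination A 1 j * A 2 j * row_sq hA 0 j
  rcases hs 0 1 with h1 | h1 <;> rcases hs 0 2 with h2 | h2 <;> rw [h1, h2] at hmul
  · refine Or.inr (rectEquiv_of_flip (by norm_num)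
      (p := fun j => A 0 j * if j = 0 then -1 else 1) (fun j => ?_) (T := Finset.univ) (by simp)
      (fun i _ => exists_flip_of_odd (fun j => ?_) (hA i) ?_) (by simp)
      fun i _ i' _ hii => hnp hii)
    · rcases hA 0 j with h | h <;> split_ifs <;> simp [h]
    · rcases hA 0 j with h | h <;> split_ifs <;> simp [h]
    · have h0 : ∏ j, A 0 j * A i j = 1 := by fin_cases i <;> simp [hself, h1, h2]
      simp only [Fin.prod_univ_four] at h0 ⊢
      simp
      linarith
  · refine Or.inl (hcenter 2 fun i hi => ?_)
    rw [hcomm]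
    fin_cases i
    exacts [h2, hmul.symm.trans (by norm_num), absurd rfl hi]
  · refine Or.inl (hcenter 1 fun i hi => ?_)
    fin_cases i
    exacts [(hcomm _ _).trans h1, absurd rfl hi, hmul.symm.trans (by norm_num)]
  · refine Or.inl (hcenter 0 fun i hi => ?_)
    fin_cases i
    exacts [absurd rfl hi, h1, h2]

end ThreeFour

theorem mper_bound_general (k n : ℕ) (hk : 2 ≤ k) (hkn : k < n)
    (A : Matrix (Fin k) (Fin n) ℚ) (hA : ∀ i j, A i j = 1 ∨ A i j = -1)
    (hrk : A.rank = k) :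
    mper A ≤ mper (Dr n k (k - 1)) ∧
      (¬(k = 3 ∧ n = 4) →
        (mper A = mper (Dr n k (k - 1)) ↔ RectEquiv A (Dr n k (k - 1)))) ∧
      (k = 3 ∧ n = 4 →
        (mper A = mper (Dr n k (k - 1)) ↔
          RectEquiv A (Dr n k 2) ∨ RectEquiv A (Dr n k 3))) := by
  have hind := ind_of_rank_eq hrk
  have hU : mper A ≤ ff n k (k - 1) := by
    have := nrmBound hA k Finset.univ Finset.univ (by simp) (by omega) (by simpa using hkn) hind
    rwa [Finset.card_univ, Fintype.card_fin, ← mper_eq_nrm] at this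
  have hL : ff n k (k - 1) ≤ mper (Dr n k (k - 1)) := by
    rw [mper_eq_nrm]
    exact ff_le_nrm_Dr (Nat.sub_le _ _) hkn.le
  refine ⟨hU.trans hL, fun h34 => ⟨fun h => ?_, RectEquiv.mper_eq⟩, ?_⟩
  · refine RowStar.rectEquiv hkn hA hind ?_
    refine rowStar_of_le hA k Finset.univ Finset.univ (by simp) hk (by simpa using hkn)
      (by simpa using h34) hind ?_
    rwa [Finset.card_univ, Fintype.card_fin, ← mper_eq_nrm, h]
  · rintro ⟨rfl, rfl⟩
    refine ⟨fun _ => rectEquiv_three_four hA hind, ?_⟩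
    rintro (h | h)
    · exact h.mper_eq
    · exact h.mper_eq.trans mper_Dr_three
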